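/- Let Ω ⊂ ℝ be an open bounded interval, let f satisfy hypothesis (F), and let K > 0. Then there exists Γ₂(K) > 0 such that if (u₀,u_{0t},Θ₀) and (û₀,û_{0t},Θ̂₀) satisfy the data hypothesis (I), if T > 0, and if (u,Θ) and (û,Θ̂) are weak solutions of system (P) on Ω×(0,T) with these respective initial data, both lying in the regularity class (R_T), and moreover ‖û_t(·,t)‖_{L²(Ω)} + ‖Θ(·,t)‖_{L¹(Ω)} ≤ K for all t ∈ (0,T), then for all t ∈ (0,T): ∫_Ω |Θ(·,t)−Θ̂(·,t)|² + ∫₀^t∫_Ω (Θ_x−Θ̂_x)² ≤ ∫_Ω |Θ₀−Θ̂₀|² + Γ₂(K)·∫₀^t {1 + ∫_Ω Θ_x²(·,s)}·{∫_Ω |u_t(·,s)−û_t(·,s)|² + ∫_Ω |Θ(·,s)−Θ̂(·,s)|²} ds. -/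

import Mathlib

open MeasureTheory Filter Set Function

noncomputable section

/-- Integral over `Ω = (a,b)`. -/
def intOm (a b : ℝ) (g : ℝ → ℝ) : ℝ := ∫ x in Ioo a b, g x

/-- Double integral over `Ω × (0,T)`. -/
def intOmT (a b T : ℝ) (F : ℝ → ℝ → ℝ) : ℝ :=
  ∫ p in (Ioo a b) ×ˢ (Ioo 0 T), F p.1 p.2

/-- Squared `L²(Ω)` integral of `g`. -/
def sqOm (a b : ℝ) (g : ℝ → ℝ) : ℝ := ∫ x in Ioo a b, (g x) ^ 2

/-- `L²(Ω)` norm. -/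
def nrmL2 (a b : ℝ) (g : ℝ → ℝ) : ℝ := (∫ x in Ioo a b, (g x) ^ 2) ^ (1 / 2 : ℝ)

/-- `L¹(Ω)` norm. -/
def nrmL1 (a b : ℝ) (g : ℝ → ℝ) : ℝ := ∫ x in Ioo a b, |g x|

/-- Membership in `L²(Ω)`. -/
def MemL2 (a b : ℝ) (g : ℝ → ℝ) : Prop :=
  AEStronglyMeasurable g (volume.restrict (Ioo a b)) ∧
    IntegrableOn (fun x => (g x) ^ 2) (Ioo a b)

/-- Zero-trace weak derivative on `(a,b)`: `g ∈ W₀^{1,1}(a,b)` with weak derivative `g'`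
(integration by parts against all smooth test functions, with no boundary terms). -/
def WeakDerivZ (a b : ℝ) (g g' : ℝ → ℝ) : Prop :=
  ∀ ψ : ℝ → ℝ, ContDiff ℝ (⊤ : ℕ∞) ψ →
    ∫ x in Ioo a b, g x * deriv ψ x = - ∫ x in Ioo a b, g' x * ψ x

/-- Interior weak derivative on `(a,b)`: `g ∈ W^{1,1}(a,b)` with weak derivative `g'`. -/
def WeakDerivI (a b : ℝ) (g g' : ℝ → ℝ) : Prop :=
  ∀ ψ : ℝ → ℝ, ContDiff ℝ (⊤ : ℕ∞) ψ → tsupport ψ ⊆ Ioo a b →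
    ∫ x in Ioo a b, g x * deriv ψ x = - ∫ x in Ioo a b, g' x * ψ x

/-- Hypothesis (F) on the nonlinearity `f`, where `f'`, `f''` denote its first and second
derivatives on `[0,∞)`: `f ∈ C²([0,∞))`, `f(0)=0`, `f' > 0` on `[0,∞)`,
and `f' ∈ W^{1,∞}((0,∞))` (i.e. `f'` and `f''` are bounded). -/
structure HypF (f f' f'' : ℝ → ℝ) : Prop where
  hasDeriv₁ : ∀ x ∈ Ici (0 : ℝ), HasDerivWithinAt f (f' x) (Ici 0) x
  hasDeriv₂ : ∀ x ∈ Ici (0 : ℝ), HasDerivWithinAt f' (f'' x) (Ici 0) x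
  cont₂ : ContinuousOn f'' (Ici 0)
  zero : f 0 = 0
  pos : ∀ x ∈ Ici (0 : ℝ), 0 < f' x
  bdd : ∃ M : ℝ, ∀ x ∈ Ici (0 : ℝ), |f' x| ≤ M ∧ |f'' x| ≤ M

/-- Partial derivative in the first (spatial) variable. -/
def pdx (w : ℝ → ℝ → ℝ) : ℝ → ℝ → ℝ := fun x t => deriv (fun y => w y t) x

/-- Partial derivative in the second (time) variable. -/
def pdt (w : ℝ → ℝ → ℝ) : ℝ → ℝ → ℝ := fun x t => deriv (fun s => w x s) t

/-- Test functions in `C₀^∞(Ω × [0,T))`. -/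
structure TestU (a b T : ℝ) (φ : ℝ → ℝ → ℝ) : Prop where
  smooth : ContDiff ℝ (⊤ : ℕ∞) (uncurry φ)
  suppx : ∃ K : Set ℝ, IsCompact K ∧ K ⊆ Ioo a b ∧ ∀ x t, x ∉ K → φ x t = 0
  suppt : ∃ T' : ℝ, T' < T ∧ ∀ x t, T' ≤ t → φ x t = 0

/-- Test functions in `C^∞(Ω̄ × [0,T))`, compactly supported in time. -/
structure TestT (T : ℝ) (φ : ℝ → ℝ → ℝ) : Prop where
  smooth : ContDiff ℝ (⊤ : ℕ∞) (uncurry φ)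
  suppt : ∃ T' : ℝ, T' < T ∧ ∀ x t, T' ≤ t → φ x t = 0

/-- Test functions in `C₀^∞(Ω × (0,T))`. -/
structure TestInt (a b T : ℝ) (φ : ℝ → ℝ → ℝ) : Prop where
  smooth : ContDiff ℝ (⊤ : ℕ∞) (uncurry φ)
  suppx : ∃ K : Set ℝ, IsCompact K ∧ K ⊆ Ioo a b ∧ ∀ x t, x ∉ K → φ x t = 0
  supptime : ∃ K : Set ℝ, IsCompact K ∧ K ⊆ Ioo 0 T ∧ ∀ x t, t ∉ K → φ x t = 0

/-- Definition (W): weak solution of (P) on `Ω × (0,T)`.  Here `ut`, `ux`, `Θx` denote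
the weak derivatives of `u` (in time and space) and of `Θ` (in space). -/
structure IsWeakSol (a b T : ℝ) (f f' : ℝ → ℝ) (u0 u0t Θ0 : ℝ → ℝ)
    (u ut ux Θ Θx : ℝ → ℝ → ℝ) : Prop where
  u_sliceL1 : ∀ t ∈ Icc 0 T, IntegrableOn (fun x => u x t) (Ioo a b)
  u_contL1 : ∀ t₀ ∈ Icc 0 T,
    Tendsto (fun t => ∫ x in Ioo a b, |u x t - u x t₀|) (nhdsWithin t₀ (Icc 0 T)) (nhds 0)
  u_int : IntegrableOn (fun p : ℝ × ℝ => u p.1 p.2) ((Ioo a b) ×ˢ (Ioo 0 T))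
  ux_int : IntegrableOn (fun p : ℝ × ℝ => ux p.1 p.2) ((Ioo a b) ×ˢ (Ioo 0 T))
  u_W0 : ∀ᵐ t ∂volume.restrict (Ioo 0 T), WeakDerivZ a b (fun x => u x t) (fun x => ux x t)
  Θ_int : IntegrableOn (fun p : ℝ × ℝ => Θ p.1 p.2) ((Ioo a b) ×ˢ (Ioo 0 T))
  Θx_int : IntegrableOn (fun p : ℝ × ℝ => Θx p.1 p.2) ((Ioo a b) ×ˢ (Ioo 0 T))
  Θ_W : ∀ᵐ t ∂volume.restrict (Ioo 0 T), WeakDerivI a b (fun x => Θ x t) (fun x => Θx x t)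
  Θ_nonneg : ∀ᵐ p ∂volume.restrict ((Ioo a b) ×ˢ (Ioo 0 T)), 0 ≤ Θ p.1 p.2
  ut_weak : ∀ φ : ℝ → ℝ → ℝ, TestInt a b T φ →
    intOmT a b T (fun x t => u x t * pdt φ x t) = - intOmT a b T (fun x t => ut x t * φ x t)
  ut_int : IntegrableOn (fun p : ℝ × ℝ => ut p.1 p.2) ((Ioo a b) ×ˢ (Ioo 0 T))
  g1_int : IntegrableOn (fun p : ℝ × ℝ => f' (Θ p.1 p.2) * Θx p.1 p.2)
    ((Ioo a b) ×ˢ (Ioo 0 T))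
  g2_int : IntegrableOn (fun p : ℝ × ℝ => f' (Θ p.1 p.2) * Θx p.1 p.2 * ut p.1 p.2)
    ((Ioo a b) ×ˢ (Ioo 0 T))
  g3_int : IntegrableOn (fun p : ℝ × ℝ => f (Θ p.1 p.2) * ut p.1 p.2)
    ((Ioo a b) ×ˢ (Ioo 0 T))
  weak_u : ∀ φ : ℝ → ℝ → ℝ, TestU a b T φ →
    intOmT a b T (fun x t => u x t * pdt (pdt φ) x t)
        - intOm a b (fun x => u0t x * φ x 0) + intOm a b (fun x => u0 x * pdt φ x 0)
      = - intOmT a b T (fun x t => ux x t * pdx φ x t)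
        - intOmT a b T (fun x t => f' (Θ x t) * Θx x t * φ x t)
  weak_Θ : ∀ φ : ℝ → ℝ → ℝ, TestT T φ →
    - intOmT a b T (fun x t => Θ x t * pdt φ x t) - intOm a b (fun x => Θ0 x * φ x 0)
      = - intOmT a b T (fun x t => Θx x t * pdx φ x t)
        + intOmT a b T (fun x t => f' (Θ x t) * Θx x t * ut x t * φ x t)
        + intOmT a b T (fun x t => f (Θ x t) * ut x t * pdx φ x t)

/-- Continuity of `t ↦ w(·,t)` as a map `J → L²(Ω)` (with slices in `L²(Ω)`). -/
def ContL2 (a b : ℝ) (J : Set ℝ) (w : ℝ → ℝ → ℝ) : Prop :=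
  (∀ t ∈ J, MemL2 a b (fun x => w x t)) ∧
    ∀ t₀ ∈ J, Tendsto (fun t => ∫ x in Ioo a b, (w x t - w x t₀) ^ 2)
      (nhdsWithin t₀ J) (nhds 0)

/-- The regularity class (R_T):  `u ∈ C⁰([0,T];W₀^{1,2})`, `u_t ∈ C⁰([0,T];L²)`,
`Θ ∈ C⁰([0,T];L²) ∩ L²((0,T);W^{1,2})`. -/
structure RegT (a b T : ℝ) (u ut ux Θ Θx : ℝ → ℝ → ℝ) : Prop where
  u_cont : ContL2 a b (Icc 0 T) u
  ux_cont : ContL2 a b (Icc 0 T) ux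
  u_W0 : ∀ t ∈ Icc (0 : ℝ) T, WeakDerivZ a b (fun x => u x t) (fun x => ux x t)
  ut_cont : ContL2 a b (Icc 0 T) ut
  Θ_cont : ContL2 a b (Icc 0 T) Θ
  Θ_sq_int : IntegrableOn (fun p : ℝ × ℝ => (Θ p.1 p.2) ^ 2) ((Ioo a b) ×ˢ (Ioo 0 T))
  Θx_sq_int : IntegrableOn (fun p : ℝ × ℝ => (Θx p.1 p.2) ^ 2) ((Ioo a b) ×ˢ (Ioo 0 T))

/-- Data hypothesis (I), with `u0x` the weak derivative of `u0 ∈ W₀^{1,2}(Ω)`. -/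
structure DataI (a b : ℝ) (u0 u0x u0t Θ0 : ℝ → ℝ) : Prop where
  u0_L2 : MemL2 a b u0
  u0x_L2 : MemL2 a b u0x
  u0_W0 : WeakDerivZ a b u0 u0x
  u0t_L2 : MemL2 a b u0t
  Θ0_L2 : MemL2 a b Θ0
  Θ0_nonneg : ∀ᵐ x ∂volume.restrict (Ioo a b), 0 ≤ Θ0 x

/-- Smooth-data hypothesis (I∞). -/
structure SmoothData (a b : ℝ) (v0 u0 Θ0 : ℝ → ℝ) : Prop where
  v0_smooth : ContDiff ℝ (⊤ : ℕ∞) v0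
  v0_supp : ∃ K : Set ℝ, IsCompact K ∧ K ⊆ Ioo a b ∧ ∀ x, x ∉ K → v0 x = 0
  u0_smooth : ContDiff ℝ (⊤ : ℕ∞) u0
  u0_supp : ∃ K : Set ℝ, IsCompact K ∧ K ⊆ Ioo a b ∧ ∀ x, x ∉ K → u0 x = 0
  Θ0_smooth : ContDiff ℝ (⊤ : ℕ∞) Θ0
  Θ0_pos : ∀ x ∈ Icc a b, 0 < Θ0 x
  Θ0x_supp : ∃ K : Set ℝ, IsCompact K ∧ K ⊆ Ioo a b ∧ ∀ x, x ∉ K → deriv Θ0 x = 0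

/-- Classical solution of the regularized problem (P_ε), of class
`C^{4,1} × C^{2,1} × C^{2,1}(Ω̄ × [0,∞))`, with positive temperature. -/
structure IsClassicalSolEps (a b : ℝ) (f : ℝ → ℝ) (ε : ℝ) (v0 u0 Θ0 : ℝ → ℝ)
    (v u Θ : ℝ → ℝ → ℝ) : Prop where
  diffx_v : ∀ k < 4, ∀ x ∈ Icc a b, ∀ t ∈ Ici (0 : ℝ),
    DifferentiableAt ℝ (fun y => pdx^[k] v y t) x
  difft_v : ∀ x ∈ Icc a b, ∀ t ∈ Ici (0 : ℝ), DifferentiableAt ℝ (fun s => v x s) t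
  cont_v : ∀ k ≤ 4, ContinuousOn (uncurry (pdx^[k] v)) ((Icc a b) ×ˢ (Ici 0))
  contt_v : ContinuousOn (uncurry (pdt v)) ((Icc a b) ×ˢ (Ici 0))
  diffx_u : ∀ k < 2, ∀ x ∈ Icc a b, ∀ t ∈ Ici (0 : ℝ),
    DifferentiableAt ℝ (fun y => pdx^[k] u y t) x
  difft_u : ∀ x ∈ Icc a b, ∀ t ∈ Ici (0 : ℝ), DifferentiableAt ℝ (fun s => u x s) t
  cont_u : ∀ k ≤ 2, ContinuousOn (uncurry (pdx^[k] u)) ((Icc a b) ×ˢ (Ici 0))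
  contt_u : ContinuousOn (uncurry (pdt u)) ((Icc a b) ×ˢ (Ici 0))
  diffx_Θ : ∀ k < 2, ∀ x ∈ Icc a b, ∀ t ∈ Ici (0 : ℝ),
    DifferentiableAt ℝ (fun y => pdx^[k] Θ y t) x
  difft_Θ : ∀ x ∈ Icc a b, ∀ t ∈ Ici (0 : ℝ), DifferentiableAt ℝ (fun s => Θ x s) t
  cont_Θ : ∀ k ≤ 2, ContinuousOn (uncurry (pdx^[k] Θ)) ((Icc a b) ×ˢ (Ici 0))
  contt_Θ : ContinuousOn (uncurry (pdt Θ)) ((Icc a b) ×ˢ (Ici 0))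
  Θ_pos : ∀ x ∈ Icc a b, ∀ t ∈ Ici (0 : ℝ), 0 < Θ x t
  eq_v : ∀ x ∈ Ioo a b, ∀ t ∈ Ioi (0 : ℝ),
    pdt v x t = -ε * pdx^[4] v x t + pdx^[2] u x t - pdx (fun y s => f (Θ y s)) x t
  eq_u : ∀ x ∈ Ioo a b, ∀ t ∈ Ioi (0 : ℝ), pdt u x t = ε * pdx^[2] u x t + v x t
  eq_Θ : ∀ x ∈ Ioo a b, ∀ t ∈ Ioi (0 : ℝ),
    pdt Θ x t = pdx^[2] Θ x t - f (Θ x t) * pdx v x t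
  bc_v : ∀ t ∈ Ioi (0 : ℝ),
    v a t = 0 ∧ v b t = 0 ∧ pdx^[2] v a t = 0 ∧ pdx^[2] v b t = 0
  bc_u : ∀ t ∈ Ioi (0 : ℝ), u a t = 0 ∧ u b t = 0
  bc_Θ : ∀ t ∈ Ioi (0 : ℝ), pdx Θ a t = 0 ∧ pdx Θ b t = 0
  init : ∀ x ∈ Icc a b, v x 0 = v0 x ∧ u x 0 = u0 x ∧ Θ x 0 = Θ0 x

/-- Weak convergence in `L²_loc(Ω̄ × [0,∞))`. -/
def WkL2loc (a b : ℝ) (wj : ℕ → ℝ → ℝ → ℝ) (w : ℝ → ℝ → ℝ) : Prop :=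
  ∀ T > (0 : ℝ), ∀ ψ : ℝ → ℝ → ℝ,
    AEStronglyMeasurable (fun p : ℝ × ℝ => ψ p.1 p.2)
      (volume.restrict ((Icc a b) ×ˢ (Icc 0 T))) →
    IntegrableOn (fun p : ℝ × ℝ => (ψ p.1 p.2) ^ 2) ((Icc a b) ×ˢ (Icc 0 T)) →
    Tendsto (fun j => ∫ p in (Icc a b) ×ˢ (Icc 0 T), wj j p.1 p.2 * ψ p.1 p.2) atTop
      (nhds (∫ p in (Icc a b) ×ˢ (Icc 0 T), w p.1 p.2 * ψ p.1 p.2))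

theorem vadd_snd_eq (r : ℝ) (p : ℝ × ℝ) : ((0, -r) : ℝ × ℝ) +ᵥ p = (p.1, p.2 - r) :=
  Prod.ext (by simp) (by simp [sub_eq_neg_add])

theorem continuous_integral_translate_mul {f g : ℝ × ℝ → ℝ}
    (hf : MemLp f 2 volume) (hg : MemLp g 2 volume) :
    Continuous fun r : ℝ => ∫ p : ℝ × ℝ, f (p.1, p.2 - r) * g p := by
  have : Fact ((2 : ENNReal) ≠ ⊤) := ⟨by simp⟩
  have key : (fun r : ℝ => ∫ p : ℝ × ℝ, f (p.1, p.2 - r) * g p) = fun r : ℝ =>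
      inner ℝ (hg.toLp g) (DomAddAct.mk ((0, -r) : ℝ × ℝ) +ᵥ hf.toLp f) := by
    funext r
    rw [L2.inner_def, DomAddAct.mk_vadd_toLp]
    apply integral_congr_ae
    have h2 := (hf.comp_measurePreserving (measurePreserving_vadd ((0, -r) : ℝ × ℝ)
      (volume : Measure (ℝ × ℝ)))).coeFn_toLp
    filter_upwards [hg.coeFn_toLp, h2] with p h1 h2
    rw [h1]
    refine Eq.trans ?_ (congrArg (inner ℝ (g p)) h2.symm)
    simp only [comp_apply, vadd_snd_eq]
    simp
  rw [key]
  refine Continuous.inner continuous_const ?_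
  have h3 : Continuous fun r : ℝ => DomAddAct.mk ((0, -r) : ℝ × ℝ) :=
    DomAddAct.continuous_mk.comp (by fun_prop)
  exact Continuous.vadd h3 continuous_const

/-- Integrability in all three variables `((t, r), y)` of the product of a square integrable
function translated in time with another one. -/
theorem integrable_translate_mul {F W : ℝ × ℝ → ℝ} (hFm : StronglyMeasurable F)
    (hWm : StronglyMeasurable W) (hF : MemLp F 2 volume) (hW : MemLp W 2 volume) (δ : ℝ) :
    Integrable (fun z : ℝ × (ℝ × ℝ) => F (z.2.1, z.2.2 - z.1) * W z.2)
      ((volume.restrict (Ioo 0 δ)).prod volume) := by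
  have hm : StronglyMeasurable (fun z : ℝ × (ℝ × ℝ) => F (z.2.1, z.2.2 - z.1) * W z.2) :=
    (hFm.comp_measurable (by fun_prop)).mul (hWm.comp_measurable (by fun_prop))
  have hFr : ∀ r : ℝ, MemLp (fun p : ℝ × ℝ => F (p.1, p.2 - r)) 2 volume := by
    intro r
    have := hF.comp_measurePreserving (measurePreserving_vadd ((0, -r) : ℝ × ℝ)
      (volume : Measure (ℝ × ℝ)))
    simpa only [Function.comp_def, vadd_snd_eq] using this
  rw [integrable_prod_iff hm.aestronglyMeasurable]
  refine ⟨Eventually.of_forall fun r => (hFr r).integrable_mul hW, ?_⟩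
  have hc := continuous_integral_translate_mul hF.abs hW.abs
  have : (fun r : ℝ => ∫ p : ℝ × ℝ, ‖F (p.1, p.2 - r) * W p‖)
      = fun r : ℝ => ∫ p : ℝ × ℝ, |F| (p.1, p.2 - r) * |W| p := by
    funext r
    simp
  rw [this]
  exact (hc.integrableOn_Icc (a := 0) (b := δ)).mono_set Ioo_subset_Icc_self

theorem integral_translate_mul_swap {F W : ℝ × ℝ → ℝ} (hFm : StronglyMeasurable F)
    (hWm : StronglyMeasurable W) (hF : MemLp F 2 volume) (hW : MemLp W 2 volume) (δ : ℝ) :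
    Integrable (fun t => ∫ r in Ioo 0 δ, ∫ y, F (y, t - r) * W (y, t)) ∧
      ∫ t, ∫ r in Ioo 0 δ, ∫ y, F (y, t - r) * W (y, t)
        = ∫ r in Ioo 0 δ, ∫ p : ℝ × ℝ, F (p.1, p.2 - r) * W p := by
  have hI := integrable_translate_mul hFm hWm hF hW δ
  have hmp : MeasurePreserving (fun z : (ℝ × ℝ) × ℝ => ((z.1.1, (z.2, z.1.2)) : ℝ × (ℝ × ℝ)))
      (((volume.restrict (Ioo 0 δ)).prod volume).prod volume)
      ((volume.restrict (Ioo 0 δ)).prod volume) := by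
    have h1 := measurePreserving_prodAssoc (volume.restrict (Ioo (0:ℝ) δ)) (volume : Measure ℝ)
      (volume : Measure ℝ)
    have h2 := (MeasurePreserving.id (volume.restrict (Ioo (0:ℝ) δ))).prod
      (Measure.measurePreserving_swap (μ := (volume : Measure ℝ)) (ν := (volume : Measure ℝ)))
    exact h2.comp h1
  have hI2 := hmp.integrable_comp_of_integrable hI
  have hI3 : Integrable (uncurry fun r t : ℝ => ∫ y, F (y, t - r) * W (y, t))
      ((volume.restrict (Ioo 0 δ)).prod volume) := hI2.integral_prod_left
  refine ⟨hI3.integral_prod_right, ?_⟩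
  rw [← integral_integral_swap hI3]
  apply integral_congr_ae
  filter_upwards [hI.prod_right_ae] with r hr
  exact (integral_prod_symm _ hr).symm

/-- A backward-in-time energy increment estimate, valid for all small time steps, implies the
energy inequality. -/
theorem energy_of_increments {τ : ℝ} (hτ : 0 < τ) {N : ℝ → ℝ} {N0 : ℝ}
    (hN : ContinuousOn N (Icc 0 τ)) {F W : ℝ × ℝ → ℝ} (hFm : StronglyMeasurable F)
    (hWm : StronglyMeasurable W) (hF : MemLp F 2 volume) (hW : MemLp W 2 volume)
    (h : ∀ δ ∈ Ioo 0 τ, ∀ᵐ t ∂volume.restrict (Ioo 0 τ),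
      N t - (if t - δ ≤ 0 then N0 else N (t - δ))
        ≤ 2 * ∫ r in Ioo 0 δ, ∫ y, F (y, t - r) * W (y, t)) :
    N τ - N0 ≤ 2 * ∫ t in Ioo 0 τ, ∫ y, F (y, t) * W (y, t) := by
  set W1 : ℝ × ℝ → ℝ := (univ ×ˢ Ioo 0 τ).indicator W with hW1
  have hS : MeasurableSet (univ ×ˢ Ioo 0 τ : Set (ℝ × ℝ)) := MeasurableSet.univ.prod measurableSet_Ioo
  have hW1m : StronglyMeasurable W1 := hWm.indicator hS
  have hW1p : MemLp W1 2 volume := hW.indicator hS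
  have hW1in : ∀ t ∈ Ioo 0 τ, ∀ y, W1 (y, t) = W (y, t) := by
    intro t ht y
    exact indicator_of_mem (by simpa using ht) _
  have hW1out : ∀ t, t ∉ Ioo 0 τ → ∀ y, W1 (y, t) = 0 := by
    intro t ht y
    exact indicator_of_notMem (by simpa using ht) _
  set J : ℝ → ℝ := fun r => ∫ p : ℝ × ℝ, F (p.1, p.2 - r) * W1 p with hJ
  have hJc : Continuous J := continuous_integral_translate_mul hF hW1p
  have hJ0 : J 0 = ∫ t in Ioo 0 τ, ∫ y, F (y, t) * W (y, t) := by
    have hI : Integrable (fun p : ℝ × ℝ => F p * W1 p) := hF.integrable_mul hW1p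
    have h1 : J 0 = ∫ t, ∫ y, F (y, t) * W1 (y, t) := by
      simp only [hJ, sub_zero]
      exact integral_prod_symm _ hI
    rw [h1, ← integral_indicator measurableSet_Ioo]
    congr 1
    funext t
    by_cases ht : t ∈ Ioo 0 τ
    · rw [indicator_of_mem ht]; simp only [hW1in t ht]
    · rw [indicator_of_notMem ht]; simp [hW1out t ht]
  rw [← hJ0]
  refine le_of_forall_pos_le_add fun ε hε => ?_
  obtain ⟨d1, hd1, hd1'⟩ := Metric.continuousAt_iff.1 (hJc.continuousAt (x := 0)) (ε / 3) (by positivity)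
  obtain ⟨d2, hd2, hd2'⟩ := Metric.continuousWithinAt_iff.1 (hN τ ⟨hτ.le, le_rfl⟩) (ε / 3)
    (by positivity)
  obtain ⟨δ, hδ0, hδ⟩ : ∃ δ, 0 < δ ∧ δ < min (min d1 d2) τ := exists_between (by positivity)
  simp only [lt_min_iff] at hδ
  obtain ⟨⟨hδ1, hδ2⟩, hδτ⟩ := hδ
  set Nt : ℝ → ℝ := fun s => if s ≤ 0 then N0 else N s with hNt
  have hNtI1 : IntervalIntegrable Nt volume (-δ) 0 := by
    refine (intervalIntegrable_const (c := N0)).congr_ae ?_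
    refine (ae_restrict_iff' measurableSet_uIoc).2 (Eventually.of_forall fun s hs => ?_)
    rw [uIoc_of_le (by linarith)] at hs
    simp [hNt, hs.2]
  have hNtI2 : ∀ c ∈ Icc 0 τ, ∀ d ∈ Icc 0 τ, IntervalIntegrable Nt volume c d := by
    intro c hc d hd
    have : IntervalIntegrable N volume c d :=
      (hN.mono (by rw [← uIcc_of_le hτ.le] at *; exact uIcc_subset_uIcc hc hd)).intervalIntegrable
    refine this.congr_ae ?_
    refine (ae_restrict_iff' measurableSet_uIoc).2 (Eventually.of_forall fun s hs => ?_)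
    have : 0 < s := lt_of_le_of_lt (le_min hc.1 hd.1) hs.1
    simp [hNt, this]
  have m0 : (0:ℝ) ∈ Icc 0 τ := ⟨le_rfl, hτ.le⟩
  have m1 : τ ∈ Icc 0 τ := ⟨hτ.le, le_rfl⟩
  have m2 : τ - δ ∈ Icc 0 τ := ⟨by linarith, by linarith⟩
  have e1 : ∫ t in (0:ℝ)..τ, Nt (t - δ) = (∫ t in (-δ)..0, Nt t) + ∫ t in (0:ℝ)..(τ - δ), Nt t := by
    rw [intervalIntegral.integral_comp_sub_right, zero_sub,
      intervalIntegral.integral_add_adjacent_intervals hNtI1 (hNtI2 _ m0 _ m2)]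
  have e2 : ∫ t in (0:ℝ)..τ, Nt t = (∫ t in (0:ℝ)..(τ - δ), Nt t) + ∫ t in (τ - δ)..τ, Nt t := by
    rw [intervalIntegral.integral_add_adjacent_intervals (hNtI2 _ m0 _ m2) (hNtI2 _ m2 _ m1)]
  have e3 : ∫ t in (-δ)..0, Nt t = δ * N0 := by
    have : ∫ t in (-δ)..0, Nt t = ∫ t in (-δ)..0, N0 := by
      refine intervalIntegral.integral_congr_ae (Eventually.of_forall fun s hs => ?_)
      rw [uIoc_of_le (by linarith)] at hs
      simp [hNt, hs.2]
    rw [this]; simp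
  have e4 : δ * (N τ - ε / 3) ≤ ∫ t in (τ - δ)..τ, Nt t := by
    have : ∫ t in (τ - δ)..τ, (N τ - ε / 3) ≤ ∫ t in (τ - δ)..τ, Nt t := by
      refine intervalIntegral.integral_mono_on (by linarith) intervalIntegrable_const
        (hNtI2 _ m2 _ m1) fun s hs => ?_
      have hs0 : 0 < s := by linarith [hs.1]
      have := hd2' (x := s) ⟨hs0.le, hs.2⟩ (by
        rw [Real.dist_eq, abs_lt]; constructor <;> linarith [hs.1, hs.2])
      rw [Real.dist_eq, abs_lt] at this
      simp only [hNt, not_le.2 hs0, if_false]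
      linarith [this.1]
    rwa [intervalIntegral.integral_const, sub_sub_cancel, smul_eq_mul] at this
  have hswap := integral_translate_mul_swap hFm hW1m hF hW1p δ
  have e5 : ∫ r in Ioo 0 δ, J r ≤ δ * (J 0 + ε / 3) := by
    have : ∫ r in Ioo 0 δ, J r ≤ ∫ r in Ioo 0 δ, (J 0 + ε / 3) := by
      refine setIntegral_mono_on ((hJc.integrableOn_Icc (a := 0) (b := δ)).mono_set
        Ioo_subset_Icc_self) (integrableOn_const (by simp)) measurableSet_Ioo fun r hr => ?_
      have := hd1' (x := r) (by rw [Real.dist_eq, abs_lt]; constructor <;> linarith [hr.1, hr.2])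
      rw [Real.dist_eq, abs_lt] at this
      linarith [this.2]
    refine this.trans (le_of_eq ?_)
    simp [hδ0.le]
  have e6 : ∫ t in Ioo 0 τ, (Nt t - Nt (t - δ))
      ≤ ∫ t in Ioo 0 τ, 2 * ∫ r in Ioo 0 δ, ∫ y, F (y, t - r) * W1 (y, t) := by
    refine integral_mono_ae ?_ (hswap.1.integrableOn.const_mul 2) ?_
    · have h1 := hNtI2 _ m0 _ m1
      have h2 : IntervalIntegrable (fun t => Nt (t - δ)) volume 0 τ := by
        have := (hNtI1.trans (hNtI2 _ m0 _ m2)).comp_sub_right δ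
        simpa using this
      have h3 := (h1.sub h2)
      rw [intervalIntegrable_iff_integrableOn_Ioo_of_le hτ.le] at h3
      exact h3
    · filter_upwards [h δ ⟨hδ0, hδτ⟩, ae_restrict_mem measurableSet_Ioo] with t h1 ht
      simp only [hW1in t ht]
      simpa only [hNt, not_le.2 ht.1, if_false] using h1
  have e7 : ∫ t in Ioo 0 τ, 2 * ∫ r in Ioo 0 δ, ∫ y, F (y, t - r) * W1 (y, t)
      = 2 * ∫ r in Ioo 0 δ, J r := by
    rw [integral_const_mul, hJ, ← hswap.2, setIntegral_eq_integral_of_forall_compl_eq_zero]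
    intro t ht
    simp [hW1out t ht]
  have e8 : ∫ t in Ioo 0 τ, (Nt t - Nt (t - δ))
      = (∫ t in (0:ℝ)..τ, Nt t) - ∫ t in (0:ℝ)..τ, Nt (t - δ) := by
    rw [← intervalIntegral.integral_sub (hNtI2 _ m0 _ m1),
      intervalIntegral.integral_of_le hτ.le, integral_Ioc_eq_integral_Ioo]
    have := (hNtI1.trans (hNtI2 _ m0 _ m2)).comp_sub_right δ
    simpa using this
  rw [e7, e8, e1, e2, e3] at e6
  have : δ * (N τ - N0) ≤ δ * (2 * J 0 + ε) := by nlinarith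
  exact le_of_mul_le_mul_left this hδ0

theorem exists_Icc_of_isCompact_subset_Ioo {a b : ℝ} (hab : a < b) {K : Set ℝ} (hK : IsCompact K)
    (hKs : K ⊆ Ioo a b) : ∃ a' b', a < a' ∧ b' < b ∧ K ⊆ Icc a' b' := by
  rcases K.eq_empty_or_nonempty with rfl | hne
  · exact ⟨(a + b) / 2, (a + b) / 2, by linarith, by linarith, by simp⟩
  · exact ⟨sInf K, sSup K, (hKs (hK.sInf_mem hne)).1, (hKs (hK.sSup_mem hne)).2,
      fun x hx => ⟨csInf_le hK.bddBelow hx, le_csSup hK.bddAbove hx⟩⟩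

theorem integral_mul_primitive {a b : ℝ} {g v : ℝ → ℝ} (hg : IntegrableOn g (Ioo a b))
    (hv : IntegrableOn v (Ioo a b)) :
    ∫ x in Ioo a b, g x * ∫ y in Ioo a x, v y = ∫ y in Ioo a b, v y * ∫ x in Ioo y b, g x := by
  have hI : Integrable (fun p : ℝ × ℝ => g p.1 * v p.2)
      ((volume.restrict (Ioo a b)).prod (volume.restrict (Ioo a b))) := hg.mul_prod hv
  have hS : MeasurableSet {p : ℝ × ℝ | p.2 < p.1} := measurableSet_lt measurable_snd measurable_fst
  have hI2 := hI.indicator hS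
  have h1 := integral_integral_swap (f := fun x y => {p : ℝ × ℝ | p.2 < p.1}.indicator
    (fun p : ℝ × ℝ => g p.1 * v p.2) (x, y)) hI2
  have e1 : ∀ x ∈ Ioo a b, (∫ y in Ioo a b, {p : ℝ × ℝ | p.2 < p.1}.indicator
    (fun p : ℝ × ℝ => g p.1 * v p.2) (x, y)) = g x * ∫ y in Ioo a x, v y := by
    intro x hx
    have : (fun y => {p : ℝ × ℝ | p.2 < p.1}.indicator (fun p : ℝ × ℝ => g p.1 * v p.2) (x, y))
        = (Iio x).indicator fun y => g x * v y := by
      funext y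
      by_cases h : y < x <;> simp [indicator, h]
    rw [this, setIntegral_indicator measurableSet_Iio, integral_const_mul,
      Ioo_inter_Iio, min_eq_right hx.2.le]
  have e2 : ∀ y ∈ Ioo a b, (∫ x in Ioo a b, {p : ℝ × ℝ | p.2 < p.1}.indicator
    (fun p : ℝ × ℝ => g p.1 * v p.2) (x, y)) = v y * ∫ x in Ioo y b, g x := by
    intro y hy
    have : (fun x => {p : ℝ × ℝ | p.2 < p.1}.indicator (fun p : ℝ × ℝ => g p.1 * v p.2) (x, y))
        = (Ioi y).indicator fun x => v y * g x := by
      funext x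
      by_cases h : y < x <;> simp [indicator, h, mul_comm]
    rw [this, setIntegral_indicator measurableSet_Ioi, integral_const_mul,
      Ioo_inter_Ioi, max_eq_right hy.1.le]
  rw [setIntegral_congr_fun measurableSet_Ioo e1, setIntegral_congr_fun measurableSet_Ioo e2] at h1
  exact h1

theorem contDiff_primitive {χ : ℝ → ℝ} (hχ : ContDiff ℝ (⊤ : ℕ∞) χ) (c : ℝ) :
    ContDiff ℝ (⊤ : ℕ∞) (fun x => ∫ y in c..x, χ y) ∧ deriv (fun x => ∫ y in c..x, χ y) = χ := by
  have h : ∀ x, HasDerivAt (fun x => ∫ y in c..x, χ y) (χ x) x := fun x =>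
    intervalIntegral.integral_hasDerivAt_right (hχ.continuous.intervalIntegrable _ _)
      (hχ.continuous.stronglyMeasurableAtFilter _ _) hχ.continuous.continuousAt
  have hd : deriv (fun x => ∫ y in c..x, χ y) = χ := funext fun x => (h x).deriv
  refine ⟨?_, hd⟩
  rw [contDiff_infty_iff_deriv]
  exact ⟨fun x => (h x).differentiableAt, by rwa [hd]⟩

/-- Vanishing against test functions on an interval. -/
theorem ae_eq_zero_of_integral_test {a b : ℝ} {e : ℝ → ℝ} (he : IntegrableOn e (Ioo a b))
    (h : ∀ χ : ℝ → ℝ, ContDiff ℝ (⊤ : ℕ∞) χ → HasCompactSupport χ → tsupport χ ⊆ Ioo a b →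
      ∫ x in Ioo a b, χ x * e x = 0) :
    ∀ᵐ x ∂volume.restrict (Ioo a b), e x = 0 := by
  rw [ae_restrict_iff' measurableSet_Ioo]
  refine isOpen_Ioo.ae_eq_zero_of_integral_contDiff_smul_eq_zero he.locallyIntegrableOn ?_
  intro χ h1 h2 h3
  rw [← h χ h1 h2 h3]
  refine (setIntegral_eq_integral_of_forall_compl_eq_zero fun x hx => ?_).symm
  rw [image_eq_zero_of_notMem_tsupport fun h' => hx (h3 h')]
  simp

theorem integrableOn_mul_of_continuous {a b : ℝ} {e χ : ℝ → ℝ} (he : IntegrableOn e (Ioo a b))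
    (hχ : Continuous χ) : IntegrableOn (fun x => χ x * e x) (Ioo a b) := by
  obtain ⟨C, hC⟩ := isCompact_Icc.exists_bound_of_continuousOn (s := Icc a b) hχ.continuousOn
  exact he.bdd_mul (c := C) hχ.aestronglyMeasurable
    ((ae_restrict_iff' measurableSet_Ioo).2 (Eventually.of_forall fun x hx =>
      hC x (Ioo_subset_Icc_self hx)))

theorem continuousOn_primitive_Ioo {a b : ℝ} {v : ℝ → ℝ} (hv : IntegrableOn v (Ioo a b)) :
    ContinuousOn (fun x => ∫ y in Ioo a x, v y) (Icc a b) := by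
  have := intervalIntegral.continuousOn_primitive (μ := volume) (f := v) (a := a) (b := b)
    (by rwa [integrableOn_Icc_iff_integrableOn_Ioo])
  simpa only [integral_Ioc_eq_integral_Ioo] using this

theorem integrableOn_primitive_Ioo {a b : ℝ} {v : ℝ → ℝ} (hv : IntegrableOn v (Ioo a b)) :
    IntegrableOn (fun x => ∫ y in Ioo a x, v y) (Ioo a b) :=
  ((continuousOn_primitive_Ioo hv).integrableOn_Icc).mono_set Ioo_subset_Icc_self

/-- The weak form of an ordinary differential equation with initial value yields its integrated
form. -/
theorem sub_eq_integral_of_weak {T : ℝ} (hT : 0 < T) {c F : ℝ → ℝ} {c0 : ℝ}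
    (hc : ContinuousOn c (Icc 0 T)) (hF : IntegrableOn F (Ioo 0 T))
    (h : ∀ η : ℝ → ℝ, ContDiff ℝ (⊤ : ℕ∞) η → (∃ T' < T, ∀ t, T' ≤ t → η t = 0) →
      -(∫ t in Ioo 0 T, c t * deriv η t) - c0 * η 0 = ∫ t in Ioo 0 T, F t * η t) :
    ∀ t ∈ Ioo 0 T, c t - c0 = ∫ s in Ioo 0 t, F s := by
  have hcI : IntegrableOn c (Ioo 0 T) := hc.integrableOn_Icc.mono_set Ioo_subset_Icc_self
  have hPI := integrableOn_primitive_Ioo hF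
  have hc0 : IntegrableOn (fun _ : ℝ => c0) (Ioo 0 T) := integrableOn_const (by simp)
  have hae : ∀ᵐ t ∂volume.restrict (Ioo 0 T), c t - c0 - (∫ s in Ioo 0 t, F s) = 0 := by
    refine ae_eq_zero_of_integral_test ((hcI.sub hc0).sub hPI) ?_
    intro χ h1 h2 h3
    obtain ⟨t0, T', ht0, hT', hsub⟩ := exists_Icc_of_isCompact_subset_Ioo hT h2 h3
    obtain ⟨p1, p2⟩ := contDiff_primitive h1 T
    have hz : ∀ t, T' < t → χ t = 0 := fun t ht =>
      image_eq_zero_of_notMem_tsupport fun h' => absurd (hsub h').2 (not_le.2 ht)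
    have hη : ∀ t ∈ Ioo 0 T, ∫ y in T..t, χ y = -∫ y in Ioo t T, χ y := by
      intro t ht
      rw [intervalIntegral.integral_symm, intervalIntegral.integral_of_le ht.2.le,
        integral_Ioc_eq_integral_Ioo]
    have hη0 : ∫ y in T..0, χ y = -∫ y in Ioo 0 T, χ y := by
      rw [intervalIntegral.integral_symm, intervalIntegral.integral_of_le hT.le,
        integral_Ioc_eq_integral_Ioo]
    have hχI : IntegrableOn χ (Ioo 0 T) :=
      (h1.continuous.integrableOn_Icc).mono_set Ioo_subset_Icc_self
    have key := h _ p1 ⟨max T' ((T' + T) / 2), by simp only [max_lt_iff]; constructor <;> linarith,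
      fun t ht => by
        have ht' : T' < t := by
          have := le_trans (le_max_right _ _) ht; linarith
        rw [intervalIntegral.integral_congr (g := fun _ => 0)]
        · simp
        · intro s hs
          refine hz s (lt_of_lt_of_le ?_ hs.1)
          exact lt_min hT' ht'⟩
    rw [p2, hη0] at key
    have e1 : ∫ t in Ioo 0 T, F t * ∫ y in T..t, χ y
        = -∫ t in Ioo 0 T, χ t * ∫ s in Ioo 0 t, F s := by
      rw [integral_mul_primitive hχI hF, ← integral_neg]
      refine setIntegral_congr_fun measurableSet_Ioo fun t ht => ?_
      simp only [hη t ht, mul_neg]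
    rw [e1] at key
    have i1 : IntegrableOn (fun t => c t * χ t) (Ioo 0 T) := by
      simpa only [mul_comm] using integrableOn_mul_of_continuous hcI h1.continuous
    have e2 : ∫ t in Ioo 0 T, χ t * (c t - c0 - ∫ s in Ioo 0 t, F s)
        = (∫ t in Ioo 0 T, c t * χ t) - (∫ t in Ioo 0 T, χ t * c0)
          - ∫ t in Ioo 0 T, χ t * ∫ s in Ioo 0 t, F s := by
      rw [← integral_sub, ← integral_sub]
      · congr 1; funext t; ring
      · exact Integrable.sub i1 (hχI.mul_const _)
      · exact integrableOn_mul_of_continuous hPI h1.continuous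
      · exact i1
      · exact hχI.mul_const _
    rw [e2, integral_mul_const]
    linarith
  have hcont : ContinuousOn (fun t => c t - c0 - ∫ s in Ioo 0 t, F s) (Ioo 0 T) :=
    ((hc.sub continuousOn_const).sub (continuousOn_primitive_Ioo hF)).mono Ioo_subset_Icc_self
  have := Measure.eqOn_open_of_ae_eq (g := fun _ => (0:ℝ)) hae isOpen_Ioo hcont continuousOn_const
  intro t ht
  have := this ht
  simp only at this
  linarith

/-- A function whose weak derivative vanishes is constant. -/
theorem exists_ae_eq_const_of_weak {a b : ℝ} (hab : a < b) {e : ℝ → ℝ}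
    (he : IntegrableOn e (Ioo a b))
    (h : ∀ ψ : ℝ → ℝ, ContDiff ℝ (⊤ : ℕ∞) ψ → tsupport ψ ⊆ Ioo a b →
      ∫ x in Ioo a b, e x * deriv ψ x = 0) :
    ∃ c, ∀ᵐ x ∂volume.restrict (Ioo a b), e x = c := by
  obtain ⟨ρ, hρs, hρc, hρr, hρ1⟩ : ∃ ρ : ℝ → ℝ, tsupport ρ ⊆ Ioo a b ∧ HasCompactSupport ρ ∧
      ContDiff ℝ (⊤ : ℕ∞) ρ ∧ ∫ x in Ioo a b, ρ x = 1 := by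
    let B : ContDiffBump ((a + b) / 2) := ⟨(b - a) / 8, (b - a) / 4, by linarith, by linarith⟩
    have hs : tsupport (B.normed volume) ⊆ Ioo a b := by
      rw [B.tsupport_normed_eq]
      intro x hx
      rw [Metric.mem_closedBall, Real.dist_eq, abs_le] at hx
      have : B.rOut = (b - a) / 4 := rfl
      rw [this] at hx
      constructor <;> linarith [hx.1, hx.2]
    refine ⟨B.normed volume, hs, B.hasCompactSupport_normed, B.contDiff_normed, ?_⟩
    rw [← B.integral_normed (μ := volume)]
    refine setIntegral_eq_integral_of_forall_compl_eq_zero fun x hx => ?_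
    exact image_eq_zero_of_notMem_tsupport fun h' => hx (hs h')
  have hint : ∀ χ : ℝ → ℝ, Continuous χ → IntegrableOn χ (Ioo a b) := fun χ hχ =>
    (hχ.integrableOn_Icc).mono_set Ioo_subset_Icc_self
  set c := ∫ x in Ioo a b, ρ x * e x with hc
  refine ⟨c, ?_⟩
  have hcI : IntegrableOn (fun _ : ℝ => c) (Ioo a b) := integrableOn_const (by simp)
  have : ∀ᵐ x ∂volume.restrict (Ioo a b), e x - c = 0 := by
    refine ae_eq_zero_of_integral_test (he.sub hcI) ?_
    intro χ h1 h2 h3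
    set m := ∫ x in Ioo a b, χ x with hm
    set χ' : ℝ → ℝ := fun x => χ x - m * ρ x with hχ'
    have hχ'r : ContDiff ℝ (⊤ : ℕ∞) χ' := h1.sub (contDiff_const.mul hρr)
    have hχ's : tsupport χ' ⊆ Ioo a b := by
      refine (tsupport_sub χ fun x => m * ρ x).trans (union_subset h3 ?_)
      exact (tsupport_mul_subset_right (f := fun _ => m)).trans hρs
    have hχ'c : IsCompact (tsupport χ') := by
      refine isCompact_Icc.of_isClosed_subset (isClosed_tsupport _)
        (hχ's.trans Ioo_subset_Icc_self)
    obtain ⟨a', b', ha', hb', hsub⟩ := exists_Icc_of_isCompact_subset_Ioo hab hχ'c hχ's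
    have hz : ∀ x, x ∉ Icc a' b' → χ' x = 0 := fun x hx =>
      image_eq_zero_of_notMem_tsupport fun h' => hx (hsub h')
    have hint0 : ∫ x in a..b, χ' x = 0 := by
      rw [intervalIntegral.integral_of_le hab.le, integral_Ioc_eq_integral_Ioo, hχ',
        integral_sub (hint _ h1.continuous) ((hint _ hρr.continuous).const_mul _),
        integral_const_mul, hρ1]
      simp [hm]
    obtain ⟨p1, p2⟩ := contDiff_primitive hχ'r a
    have hp0 : ∀ x, x ∉ Icc a' b' → ∫ y in a..x, χ' y = 0 := by
      intro x hx
      rcases lt_or_ge x a' with hxa | hxa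
      · rw [intervalIntegral.integral_congr (g := fun _ => 0)]
        · simp
        · intro s hs
          exact hz s fun hs' => absurd (hs'.1.trans hs.2) (not_le.2 (max_lt ha' hxa))
      · have hxb : b' < x := by
          by_contra hcon
          exact hx ⟨hxa, not_lt.1 hcon⟩
        rw [← intervalIntegral.integral_add_adjacent_intervals
          (hχ'r.continuous.intervalIntegrable a b) (hχ'r.continuous.intervalIntegrable b x),
          hint0, intervalIntegral.integral_congr (g := fun _ => 0)]
        · simp
        · intro s hs
          exact hz s fun hs' => absurd (hs.1.trans hs'.2) (not_le.2 (lt_min hb' hxb))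
    have key := h _ p1 (by
      refine (closure_minimal ?_ isClosed_Icc).trans (Icc_subset_Ioo ha' hb')
      intro x hx
      by_contra hcon
      exact hx (hp0 x hcon))
    rw [p2] at key
    have i1 := integrableOn_mul_of_continuous he h1.continuous
    have i2 := integrableOn_mul_of_continuous he hρr.continuous
    have e1 : ∫ x in Ioo a b, e x * χ' x = (∫ x in Ioo a b, χ x * e x) - m * c := by
      rw [hc, ← integral_const_mul, ← integral_sub i1 (i2.const_mul _)]
      congr 1; funext x; simp only [hχ']; ring
    have e2 : ∫ x in Ioo a b, χ x * (e x - c) = (∫ x in Ioo a b, χ x * e x) - m * c := by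
      rw [hm, ← integral_mul_const, ← integral_sub i1 ((hint _ h1.continuous).mul_const _)]
      congr 1; funext x; ring
    rw [e2, ← e1, key]
  filter_upwards [this] with x hx
  linarith

/-- A function with an integrable weak derivative is a primitive of it. -/
theorem WeakDerivI.exists_eq_primitive {a b : ℝ} (hab : a < b) {g g' : ℝ → ℝ}
    (hg : IntegrableOn g (Ioo a b)) (hg' : IntegrableOn g' (Ioo a b)) (h : WeakDerivI a b g g') :
    ∃ c, ∀ᵐ x ∂volume.restrict (Ioo a b), g x = c + ∫ y in Ioo a x, g' y := by
  have hP := integrableOn_primitive_Ioo hg'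
  obtain ⟨c, hc⟩ := exists_ae_eq_const_of_weak hab (hg.sub hP) (by
    intro ψ h1 h2
    have hψ' : Continuous (deriv ψ) := h1.continuous_deriv (by simp)
    have hψ'I : IntegrableOn (deriv ψ) (Ioo a b) :=
      (hψ'.integrableOn_Icc).mono_set Ioo_subset_Icc_self
    have hb0 : ψ b = 0 := image_eq_zero_of_notMem_tsupport fun h' => lt_irrefl _ (h2 h').2
    have e1 : ∫ x in Ioo a b, deriv ψ x * ∫ y in Ioo a x, g' y
        = -∫ x in Ioo a b, g' x * ψ x := by
      rw [integral_mul_primitive hψ'I hg', ← integral_neg]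
      refine setIntegral_congr_fun measurableSet_Ioo fun y hy => ?_
      have : ∫ x in Ioo y b, deriv ψ x = - ψ y := by
        rw [← integral_Ioc_eq_integral_Ioo, ← intervalIntegral.integral_of_le hy.2.le,
          intervalIntegral.integral_deriv_eq_sub
            (fun x _ => (h1.differentiable (by simp)).differentiableAt)
            (hψ'.intervalIntegrable _ _), hb0, zero_sub]
      simp only [this, mul_neg]
    have e2 := h ψ h1 h2
    have i1 := integrableOn_mul_of_continuous hg hψ'
    have i2 := integrableOn_mul_of_continuous hP hψ'
    calc ∫ x in Ioo a b, ((g - fun x => ∫ y in Ioo a x, g' y) x) * deriv ψ x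
        = (∫ x in Ioo a b, deriv ψ x * g x) - ∫ x in Ioo a b, deriv ψ x * ∫ y in Ioo a x, g' y := by
          rw [← integral_sub i1 i2]
          congr 1; funext x; simp only [Pi.sub_apply]; ring
      _ = 0 := by
          rw [e1, ← e2]; simp only [mul_comm, sub_self])
  refine ⟨c, ?_⟩
  filter_upwards [hc] with x hx
  simp only [Pi.sub_apply] at hx
  linarith

theorem sq_integral_mul_le {α : Type*} [MeasurableSpace α] {μ : Measure α} {f g : α → ℝ}
    (hf : MemLp f 2 μ) (hg : MemLp g 2 μ) :
    (∫ x, f x * g x ∂μ) ^ 2 ≤ (∫ x, f x ^ 2 ∂μ) * ∫ x, g x ^ 2 ∂μ := by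
  have e : ∀ {u v : α → ℝ} (hu : MemLp u 2 μ) (hv : MemLp v 2 μ),
      inner ℝ (hu.toLp u) (hv.toLp v) = ∫ x, u x * v x ∂μ := by
    intro u v hu hv
    rw [L2.inner_def]
    apply integral_congr_ae
    filter_upwards [hu.coeFn_toLp, hv.coeFn_toLp] with x h1 h2
    rw [h1, h2]
    simp [mul_comm]
  have h := real_inner_mul_inner_self_le (hf.toLp f) (hg.toLp g)
  rw [e, e, e] at h
  simpa only [sq] using h

theorem MemL2.memLp {a b : ℝ} {g : ℝ → ℝ} (h : MemL2 a b g) :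
    MemLp g 2 (volume.restrict (Ioo a b)) :=
  (memLp_two_iff_integrable_sq h.1).2 h.2

theorem MemL2.integrableOn {a b : ℝ} {g : ℝ → ℝ} (h : MemL2 a b g) :
    IntegrableOn g (Ioo a b) :=
  h.memLp.integrable one_le_two

theorem memL2_of_memLp {a b : ℝ} {g : ℝ → ℝ} (h : MemLp g 2 (volume.restrict (Ioo a b))) :
    MemL2 a b g :=
  ⟨h.1, (memLp_two_iff_integrable_sq h.1).1 h⟩

theorem MemL2.sub {a b : ℝ} {g h : ℝ → ℝ} (hg : MemL2 a b g) (hh : MemL2 a b h) :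
    MemL2 a b (fun x => g x - h x) :=
  memL2_of_memLp (hg.memLp.sub hh.memLp)

theorem sq_integral_le {a b : ℝ} (hab : a ≤ b) {g : ℝ → ℝ}
    (h : MemLp g 2 (volume.restrict (Ioo a b))) :
    (∫ x in Ioo a b, |g x|) ^ 2 ≤ (b - a) * ∫ x in Ioo a b, g x ^ 2 := by
  have := sq_integral_mul_le (memLp_const (1 : ℝ) (μ := volume.restrict (Ioo a b)) (p := 2)) h.abs
  simpa [hab] using this

theorem ContL2.continuousOn_integral_mul {a b : ℝ} {J : Set ℝ} {w : ℝ → ℝ → ℝ}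
    (hw : ContL2 a b J w) {ψ : ℝ → ℝ} (hψ : MemLp ψ 2 (volume.restrict (Ioo a b))) :
    ContinuousOn (fun t => ∫ x in Ioo a b, w x t * ψ x) J := by
  intro t₀ ht₀
  have h1 := hw.2 t₀ ht₀
  have h2 : Tendsto (fun t => Real.sqrt ((∫ x in Ioo a b, (w x t - w x t₀) ^ 2)
      * ∫ x in Ioo a b, ψ x ^ 2)) (nhdsWithin t₀ J) (nhds 0) := by
    have := (h1.mul_const (∫ x in Ioo a b, ψ x ^ 2)).sqrt
    simpa using this
  refine tendsto_iff_norm_sub_tendsto_zero.2 (squeeze_zero' (Eventually.of_forall fun t =>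
    norm_nonneg _) ?_ h2)
  filter_upwards [self_mem_nhdsWithin] with t ht
  have i1 : Integrable (fun x => w x t * ψ x) (volume.restrict (Ioo a b)) :=
    (hw.1 t ht).memLp.integrable_mul hψ
  have i2 : Integrable (fun x => w x t₀ * ψ x) (volume.restrict (Ioo a b)) :=
    (hw.1 t₀ ht₀).memLp.integrable_mul hψ
  have h3 := sq_integral_mul_le ((hw.1 t ht).sub (hw.1 t₀ ht₀)).memLp hψ
  rw [← integral_sub i1 i2, Real.norm_eq_abs]
  refine Real.abs_le_sqrt ?_
  simpa only [sub_mul] using h3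

theorem ContL2.continuousOn_sq {a b : ℝ} {J : Set ℝ} {w : ℝ → ℝ → ℝ} (hw : ContL2 a b J w) :
    ContinuousOn (fun t => ∫ x in Ioo a b, w x t ^ 2) J := by
  intro t₀ ht₀
  have h1 := hw.2 t₀ ht₀
  have h2 := hw.continuousOn_integral_mul (hw.1 t₀ ht₀).memLp t₀ ht₀
  have h3 : Tendsto (fun t => (∫ x in Ioo a b, (w x t - w x t₀) ^ 2)
      + 2 * (∫ x in Ioo a b, w x t * w x t₀) - ∫ x in Ioo a b, w x t₀ * w x t₀)
      (nhdsWithin t₀ J) (nhds (0 + 2 * (∫ x in Ioo a b, w x t₀ * w x t₀)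
        - ∫ x in Ioo a b, w x t₀ * w x t₀)) :=
    (h1.add (Tendsto.const_mul 2 h2)).sub tendsto_const_nhds
  have e : 0 + 2 * (∫ x in Ioo a b, w x t₀ * w x t₀) - ∫ x in Ioo a b, w x t₀ * w x t₀
      = ∫ x in Ioo a b, w x t₀ ^ 2 := by
    simp only [sq]; ring
  rw [e] at h3
  refine h3.congr' ?_
  filter_upwards [self_mem_nhdsWithin] with t ht
  have i1 : Integrable (fun x => w x t * w x t₀) (volume.restrict (Ioo a b)) :=
    (hw.1 t ht).memLp.integrable_mul (hw.1 t₀ ht₀).memLp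
  have i2 : Integrable (fun x => w x t₀ * w x t₀) (volume.restrict (Ioo a b)) :=
    (hw.1 t₀ ht₀).memLp.integrable_mul (hw.1 t₀ ht₀).memLp
  have i3 : Integrable (fun x => (w x t - w x t₀) ^ 2) (volume.restrict (Ioo a b)) :=
    ((hw.1 t ht).sub (hw.1 t₀ ht₀)).2
  have i4 : Integrable (fun x => (w x t - w x t₀) ^ 2 + 2 * (w x t * w x t₀))
      (volume.restrict (Ioo a b)) := i3.add (i1.const_mul 2)
  rw [← integral_const_mul, ← integral_add i3 (i1.const_mul 2), ← integral_sub i4 i2]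
  congr 1
  funext x
  ring

theorem ContL2.sub {a b : ℝ} {J : Set ℝ} {w v : ℝ → ℝ → ℝ} (hw : ContL2 a b J w)
    (hv : ContL2 a b J v) : ContL2 a b J (fun x t => w x t - v x t) := by
  refine ⟨fun t ht => (hw.1 t ht).sub (hv.1 t ht), fun t₀ ht₀ => ?_⟩
  have h := ((hw.2 t₀ ht₀).const_mul 2).add ((hv.2 t₀ ht₀).const_mul 2)
  simp only [mul_zero, add_zero] at h
  refine squeeze_zero' (Eventually.of_forall fun t => by positivity) ?_ h
  filter_upwards [self_mem_nhdsWithin] with t ht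
  have i1 := ((hw.1 t ht).sub (hw.1 t₀ ht₀)).2
  have i2 := ((hv.1 t ht).sub (hv.1 t₀ ht₀)).2
  rw [← integral_const_mul, ← integral_const_mul, ← integral_add (i1.const_mul 2) (i2.const_mul 2)]
  refine integral_mono (((hw.1 t ht).sub (hv.1 t ht)).sub ((hw.1 t₀ ht₀).sub (hv.1 t₀ ht₀))).2
    ((i1.const_mul 2).add (i2.const_mul 2)) fun x => ?_
  nlinarith [sq_nonneg ((w x t - w x t₀) + (v x t - v x t₀))]

theorem setIntegral_Ioo_add {A y b : ℝ} {d : ℝ → ℝ} (hd : IntegrableOn d (Ioo A b))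
    (hy : y ∈ Icc A b) :
    (∫ x in Ioo A y, d x) + ∫ x in Ioo y b, d x = ∫ x in Ioo A b, d x := by
  have h1 : IntervalIntegrable d volume A y :=
    (intervalIntegrable_iff_integrableOn_Ioo_of_le hy.1).2 (hd.mono_set (Ioo_subset_Ioo_right hy.2))
  have h2 : IntervalIntegrable d volume y b :=
    (intervalIntegrable_iff_integrableOn_Ioo_of_le hy.2).2 (hd.mono_set (Ioo_subset_Ioo_left hy.1))
  have := intervalIntegral.integral_add_adjacent_intervals h1 h2
  simpa only [intervalIntegral.integral_of_le hy.1, intervalIntegral.integral_of_le hy.2,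
    intervalIntegral.integral_of_le (hy.1.trans hy.2), integral_Ioc_eq_integral_Ioo] using this

theorem integrableOn_coprimitive_Ioo {A b : ℝ} {d : ℝ → ℝ} (hd : IntegrableOn d (Ioo A b)) :
    IntegrableOn (fun y => ∫ x in Ioo y b, d x) (Ioo A b) := by
  have h : IntegrableOn (fun y => (∫ x in Ioo A b, d x) - ∫ x in Ioo A y, d x) (Ioo A b) :=
    (integrableOn_const (by simp)).sub (integrableOn_primitive_Ioo hd)
  refine h.congr_fun (fun y hy => ?_) measurableSet_Ioo
  have := setIntegral_Ioo_add hd (Ioo_subset_Icc_self hy)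
  simp only
  linarith

theorem Integrable.mul_bounded_on {S : Set (ℝ × ℝ)} (hS : MeasurableSet S) {F φ : ℝ × ℝ → ℝ}
    (hF : IntegrableOn F S) (hφ : Continuous φ) (hSb : Bornology.IsBounded S) :
    IntegrableOn (fun p => F p * φ p) S := by
  obtain ⟨C, hC⟩ := (hSb.isCompact_closure).exists_bound_of_continuousOn hφ.continuousOn
  exact hF.mul_bdd (c := C) hφ.aestronglyMeasurable
    ((ae_restrict_iff' hS).2 (Eventually.of_forall fun x hx => hC x (subset_closure hx)))

theorem coprimitive_ae_eq_of_weak {A b : ℝ} {d p : ℝ → ℝ} (hd : IntegrableOn d (Ioo A b))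
    (hp : IntegrableOn p (Ioo A b))
    (h : ∀ ψ : ℝ → ℝ, ContDiff ℝ (⊤ : ℕ∞) ψ →
      ∫ x in Ioo A b, d x * ψ x = ∫ x in Ioo A b, p x * deriv ψ x) :
    ∀ᵐ y ∂volume.restrict (Ioo A b), ∫ x in Ioo y b, d x = p y := by
  have hco := integrableOn_coprimitive_Ioo hd
  have := ae_eq_zero_of_integral_test (hco.sub hp) (by
    intro χ h1 _ _
    obtain ⟨h2, h3⟩ := contDiff_primitive h1 A
    have h4 := h _ h2
    rw [h3] at h4
    have hχ : IntegrableOn χ (Ioo A b) :=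
      (h1.continuous.integrableOn_Icc (a := A) (b := b)).mono_set Ioo_subset_Icc_self
    have h5 : ∫ x in Ioo A b, d x * ∫ y in A..x, χ y = ∫ y in Ioo A b, χ y * ∫ x in Ioo y b, d x := by
      rw [← integral_mul_primitive hd hχ]
      refine setIntegral_congr_fun measurableSet_Ioo fun x hx => ?_
      simp only [intervalIntegral.integral_of_le hx.1.le, integral_Ioc_eq_integral_Ioo]
    have i1 := integrableOn_mul_of_continuous hco h1.continuous
    have i2 := integrableOn_mul_of_continuous hp h1.continuous
    simp only [Pi.sub_apply, mul_sub]
    rw [integral_sub i1 i2, ← h5, h4, sub_eq_zero]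
    simp only [mul_comm])
  filter_upwards [this] with y hy
  simpa [sub_eq_zero] using hy

theorem setIntegral_Ioo_comp_sub_left {t δ : ℝ} (hδ : 0 ≤ δ) (q : ℝ → ℝ) :
    ∫ r in Ioo 0 δ, q (t - r) = ∫ s in Ioo (t - δ) t, q s := by
  have := intervalIntegral.integral_comp_sub_left q t (a := 0) (b := δ)
  simpa only [intervalIntegral.integral_of_le hδ, sub_zero,
    intervalIntegral.integral_of_le (sub_le_self t hδ), integral_Ioc_eq_integral_Ioo] using this

theorem ae_integrable_slice_translate_mul {F W : ℝ × ℝ → ℝ} (hFm : StronglyMeasurable F)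
    (hWm : StronglyMeasurable W) (hF : MemLp F 2 volume) (hW : MemLp W 2 volume) (δ : ℝ) :
    ∀ᵐ t, Integrable (fun z : ℝ × ℝ => F (z.2, t - z.1) * W (z.2, t))
      ((volume.restrict (Ioo 0 δ)).prod volume) := by
  have hI := integrable_translate_mul hFm hWm hF hW δ
  have h1 := measurePreserving_prodAssoc (volume.restrict (Ioo (0:ℝ) δ)) (volume : Measure ℝ)
      (volume : Measure ℝ)
  have h2 := (h1.integrable_comp_emb (MeasurableEquiv.measurableEmbedding _)).2 hI
  exact h2.prod_left_ae

theorem energy_inequality_of_potential {A a b τ : ℝ} (hAa : A ≤ a) (hτ : 0 < τ)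
    {w : ℝ → ℝ → ℝ} {w0 : ℝ → ℝ}
    (hN : ContinuousOn (fun t => ∫ x in Ioo a b, w x t ^ 2) (Icc 0 τ))
    (hw : ∀ t ∈ Icc 0 τ, MemL2 a b (fun x => w x t)) (hw0 : MemL2 a b w0)
    {Q W : ℝ × ℝ → ℝ} (hQm : StronglyMeasurable Q) (hWm : StronglyMeasurable W)
    (hQ : MemLp Q 2 volume) (hW : MemLp W 2 volume)
    (hQ0 : ∀ y s, y ∉ Ioo A b → Q (y, s) = 0) (hQ1 : ∀ y s, s ≤ 0 → Q (y, s) = 0)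
    (hpot : ∀ t ∈ Ioo 0 τ, ∀ᵐ y ∂volume.restrict (Ioo A b),
      ∫ x in Ioo y b, (Ioo a b).indicator (fun x => w x t - w0 x) x = ∫ s in Ioo 0 t, Q (y, s))
    (hrep : ∀ᵐ t ∂volume.restrict (Ioo 0 τ), ∀ᵐ x ∂volume.restrict (Ioo a b),
      w x t = ∫ y in Ioo A x, W (y, t)) :
    (∫ x in Ioo a b, w x τ ^ 2) - ∫ x in Ioo a b, w0 x ^ 2
      ≤ 2 * ∫ t in Ioo 0 τ, ∫ y, Q (y, t) * W (y, t) := by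
  refine energy_of_increments hτ hN hQm hWm hQ hW ?_
  intro δ hδ
  have hWs : ∀ᵐ t, Integrable (fun y => W (y, t) ^ 2) := hW.integrable_sq.prod_left_ae
  have hQs : ∀ᵐ y, Integrable (fun s => Q (y, s) ^ 2) := hQ.integrable_sq.prod_right_ae
  have hQI : ∀ᵐ y, ∀ c d : ℝ, IntegrableOn (fun s => Q (y, s)) (Ioo c d) := by
    filter_upwards [hQs] with y hy c d
    exact (((memLp_two_iff_integrable_sq (hQm.comp_measurable (by fun_prop)).aestronglyMeasurable).2
      hy).restrict (Ioo c d)).integrable one_le_two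
  filter_upwards [hrep, ae_restrict_of_ae hWs,
    ae_restrict_of_ae (ae_integrable_slice_translate_mul hQm hWm hQ hW δ),
    ae_restrict_mem measurableSet_Ioo] with t h1 h2 h3 ht
  have hWI : IntegrableOn (fun y => W (y, t)) (Ioo A b) :=
    (((memLp_two_iff_integrable_sq (hWm.comp_measurable (by fun_prop)).aestronglyMeasurable).2
      h2).restrict (Ioo A b)).integrable one_le_two
  set wt : ℝ → ℝ := if t - δ ≤ 0 then w0 else fun x => w x (t - δ) with hwt
  have hwtL : MemL2 a b wt := by
    by_cases hc : t - δ ≤ 0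
    · simpa [hwt, hc] using hw0
    · simpa [hwt, hc] using hw (t - δ) ⟨by linarith, by linarith [ht.2, hδ.1]⟩
  have hwL := hw t (Ioo_subset_Icc_self ht)
  have hind : ∀ {v : ℝ → ℝ}, MemL2 a b v → IntegrableOn ((Ioo a b).indicator v) (Ioo A b) :=
    fun hv => (hv.integrableOn.integrable_indicator measurableSet_Ioo).integrableOn
  have hpotδ : ∀ᵐ y ∂volume.restrict (Ioo A b),
      ∫ x in Ioo y b, (Ioo a b).indicator (fun x => w x t - wt x) x
        = ∫ r in Ioo 0 δ, Q (y, t - r) := by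
    by_cases hc : t - δ ≤ 0
    · filter_upwards [hpot t ht] with y hy
      simp only [hwt, hc, if_true]
      rw [hy, setIntegral_Ioo_comp_sub_left hδ.1.le (fun s => Q (y, s))]
      refine (setIntegral_eq_of_subset_of_forall_sdiff_eq_zero measurableSet_Ioo
        (Ioo_subset_Ioo_left hc) fun s hs => hQ1 y s ?_).symm
      by_contra hs0
      exact hs.2 ⟨not_le.1 hs0, hs.1.2⟩
    · push Not at hc
      have ht' : t - δ ∈ Ioo 0 τ := ⟨hc, by linarith [ht.2, hδ.1]⟩
      filter_upwards [hpot t ht, hpot (t - δ) ht', ae_restrict_of_ae hQI,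
        ae_restrict_mem measurableSet_Ioo] with y hy hy' hyI hyA
      rw [setIntegral_Ioo_comp_sub_left hδ.1.le (fun s => Q (y, s))]
      have e := setIntegral_Ioo_add (hyI 0 t) (y := t - δ) ⟨hc.le, by linarith [hδ.1]⟩
      rw [← hy, ← hy'] at e
      have i1 := (hind (hwL.sub hw0)).mono_set (Ioo_subset_Ioo_left (b := b) hyA.1.le)
      have i2 := (hind ((hw (t - δ) (Ioo_subset_Icc_self ht')).sub hw0)).mono_set
        (Ioo_subset_Ioo_left (b := b) hyA.1.le)
      rw [← sub_eq_iff_eq_add'.2 e.symm, ← integral_sub i1 i2]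
      congr 1
      funext x
      simp only [hwt, not_le.2 hc, if_false, indicator]
      split_ifs <;> ring
  have key : ∫ x in Ioo a b, (w x t - wt x) * w x t
      = ∫ r in Ioo 0 δ, ∫ y, Q (y, t - r) * W (y, t) := by
    calc ∫ x in Ioo a b, (w x t - wt x) * w x t
        = ∫ x in Ioo a b, (w x t - wt x) * ∫ y in Ioo A x, W (y, t) := by
          refine integral_congr_ae ?_
          filter_upwards [h1] with x hx
          rw [← hx]
      _ = ∫ x in Ioo A b, (Ioo a b).indicator (fun x => w x t - wt x) x * ∫ y in Ioo A x, W (y, t) := by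
          refine Eq.trans ?_ (setIntegral_eq_of_subset_of_forall_sdiff_eq_zero measurableSet_Ioo
            (Ioo_subset_Ioo_left hAa) fun x hx => by simp [indicator_of_notMem hx.2]).symm
          refine setIntegral_congr_fun measurableSet_Ioo fun x hx => ?_
          simp only [indicator_of_mem hx]
      _ = ∫ y in Ioo A b, W (y, t) * ∫ x in Ioo y b, (Ioo a b).indicator (fun x => w x t - wt x) x :=
          integral_mul_primitive (hind (hwL.sub hwtL)) hWI
      _ = ∫ y in Ioo A b, ∫ r in Ioo 0 δ, Q (y, t - r) * W (y, t) := by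
          refine integral_congr_ae ?_
          filter_upwards [hpotδ] with y hy
          rw [hy, mul_comm, integral_mul_const]
      _ = ∫ y, ∫ r in Ioo 0 δ, Q (y, t - r) * W (y, t) := by
          refine setIntegral_eq_integral_of_forall_compl_eq_zero fun y hy => ?_
          simp [hQ0 y _ hy]
      _ = ∫ r in Ioo 0 δ, ∫ y, Q (y, t - r) * W (y, t) := by
          rw [integral_integral_swap]
          exact h3.swap
  rw [← key]
  have e1 : (if t - δ ≤ 0 then ∫ x in Ioo a b, w0 x ^ 2 else ∫ x in Ioo a b, w x (t - δ) ^ 2)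
      = ∫ x in Ioo a b, wt x ^ 2 := by
    by_cases hc : t - δ ≤ 0 <;> simp [hwt, hc]
  rw [e1, ← integral_sub hwL.2 hwtL.2, ← integral_const_mul]
  refine integral_mono (hwL.2.sub hwtL.2)
    (((hwL.sub hwtL).memLp.integrable_mul hwL.memLp).const_mul 2) fun x => ?_
  nlinarith [sq_nonneg (w x t - wt x)]

theorem Integrable.mul_continuous_of_bounded {S : Set (ℝ × ℝ)} (hS : MeasurableSet S)
    (hSb : Bornology.IsBounded S) {F φ : ℝ × ℝ → ℝ} (hF : Integrable F)
    (hF0 : ∀ p ∉ S, F p = 0) (hφ : Continuous φ) : Integrable (fun p => F p * φ p) := by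
  rw [← integrableOn_iff_integrable_of_support_subset (s := S)]
  · exact Integrable.mul_bounded_on hS hF.integrableOn hφ hSb
  · intro p hp
    by_contra h
    simp [hF0 p h] at hp

theorem isBounded_Ioo_prod (a b c d : ℝ) :
    Bornology.IsBounded (Ioo a b ×ˢ Ioo c d : Set (ℝ × ℝ)) :=
  (Metric.isBounded_Ioo a b).prod (Metric.isBounded_Ioo c d)

theorem memLp_two_of_continuous (a b : ℝ) {ψ : ℝ → ℝ} (hψ : Continuous ψ) :
    MemLp ψ 2 (volume.restrict (Ioo a b)) := by
  obtain ⟨C, hC⟩ := isCompact_Icc.exists_bound_of_continuousOn (s := Icc a b) hψ.continuousOn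
  exact MemLp.of_bound hψ.aestronglyMeasurable C
    ((ae_restrict_iff' measurableSet_Ioo).2 (Eventually.of_forall fun x hx =>
      hC x (Ioo_subset_Icc_self hx)))

theorem potential_of_weak {A a b T t : ℝ} (hAa : A ≤ a) {d : ℝ → ℝ}
    (hd : IntegrableOn d (Ioo a b)) {P g : ℝ × ℝ → ℝ}
    (hP : Integrable P) (hg : Integrable g)
    (hP0 : ∀ p ∉ Ioo a b ×ˢ Ioo 0 T, P p = 0) (hg0 : ∀ p ∉ Ioo a b ×ˢ Ioo 0 T, g p = 0)
    (h : ∀ ψ : ℝ → ℝ, ContDiff ℝ (⊤ : ℕ∞) ψ → ∫ x in Ioo a b, d x * ψ x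
      = ∫ s in Ioo 0 t, ∫ x in Ioo a b, (P (x, s) * deriv ψ x + g (x, s) * ψ x)) :
    ∀ᵐ y ∂volume.restrict (Ioo A b), ∫ x in Ioo y b, (Ioo a b).indicator d x
      = ∫ s in Ioo 0 t, (P (y, s) + ∫ x in Ioo y b, g (x, s)) := by
  have hsl : ∀ {F : ℝ × ℝ → ℝ} (U : Set ℝ), Integrable F →
      Integrable F ((volume.restrict U).prod (volume.restrict (Ioo 0 t))) := by
    intro F U hF
    rw [Measure.prod_restrict]
    exact hF.restrict
  have hS : MeasurableSet (Ioo a b ×ˢ Ioo 0 T : Set (ℝ × ℝ)) := measurableSet_Ioo.prod measurableSet_Ioo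
  have hz : ∀ {F : ℝ × ℝ → ℝ}, (∀ p ∉ Ioo a b ×ˢ Ioo 0 T, F p = 0) → ∀ x ∉ Ioo a b,
      ∫ s in Ioo 0 t, F (x, s) = 0 := by
    intro F hF x hx
    simp [hF (x, _) fun h => hx h.1]
  have hGI : IntegrableOn (fun x => ∫ s in Ioo 0 t, g (x, s)) (Ioo A b) :=
    (hsl (Ioo A b) hg).integral_prod_left
  have hPI : IntegrableOn (fun x => ∫ s in Ioo 0 t, P (x, s)) (Ioo A b) :=
    (hsl (Ioo A b) hP).integral_prod_left
  have hdI : IntegrableOn ((Ioo a b).indicator d) (Ioo A b) :=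
    (hd.integrable_indicator measurableSet_Ioo).integrableOn
  have hext : ∀ {q : ℝ → ℝ}, (∀ x ∉ Ioo a b, q x = 0) →
      ∫ x in Ioo A b, q x = ∫ x in Ioo a b, q x := fun hq =>
    setIntegral_eq_of_subset_of_forall_sdiff_eq_zero measurableSet_Ioo
      (Ioo_subset_Ioo_left hAa) fun x hx => hq x hx.2
  have hco := coprimitive_ae_eq_of_weak (hdI.sub hGI) hPI (by
    intro ψ hψ
    have hψ' : Continuous (deriv ψ) := hψ.continuous_deriv (by simp)
    have iP := Integrable.mul_continuous_of_bounded hS (isBounded_Ioo_prod a b 0 T) hP hP0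
      (hψ'.comp continuous_fst)
    have ig := Integrable.mul_continuous_of_bounded hS (isBounded_Ioo_prod a b 0 T) hg hg0
      (hψ.continuous.comp continuous_fst)
    rw [hext fun x hx => by simp [indicator_of_notMem hx, hz hg0 x hx],
      hext fun x hx => by simp [hz hP0 x hx]]
    have e1 : ∀ x ∈ Ioo a b, ((Ioo a b).indicator d - fun x => ∫ s in Ioo 0 t, g (x, s)) x * ψ x
        = d x * ψ x - ∫ s in Ioo 0 t, g (x, s) * ψ x := by
      intro x hx
      rw [Pi.sub_apply, indicator_of_mem hx, sub_mul, integral_mul_const]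
    have jP : IntegrableOn (fun x => ∫ s in Ioo 0 t, P (x, s) * deriv ψ x) (Ioo a b) :=
      (hsl (Ioo a b) iP).integral_prod_left
    have jg : IntegrableOn (fun x => ∫ s in Ioo 0 t, g (x, s) * ψ x) (Ioo a b) :=
      (hsl (Ioo a b) ig).integral_prod_left
    have jd : IntegrableOn (fun x => d x * ψ x) (Ioo a b) := by
      simpa only [mul_comm] using integrableOn_mul_of_continuous hd hψ.continuous
    rw [setIntegral_congr_fun measurableSet_Ioo e1, integral_sub jd jg, h ψ hψ,
      ← integral_integral_swap (f := fun x s => P (x, s) * deriv ψ x + g (x, s) * ψ x)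
        ((hsl (Ioo a b) iP).add (hsl (Ioo a b) ig)), ← integral_sub _ jg]
    · refine integral_congr_ae ?_
      filter_upwards [(hsl (Ioo a b) iP).prod_right_ae, (hsl (Ioo a b) ig).prod_right_ae] with x h1 h2
      simp only [comp_apply] at h1 h2
      rw [integral_add h1 h2, add_sub_cancel_right, integral_mul_const]
    · exact ((hsl (Ioo a b) iP).add (hsl (Ioo a b) ig)).integral_prod_left)
  filter_upwards [hco, (hsl (Ioo A b) hP).prod_right_ae, ae_restrict_mem measurableSet_Ioo]
    with y h1 h2 hy
  have hsub : Ioo y b ⊆ Ioo A b := Ioo_subset_Ioo_left hy.1.le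
  have h3 := (hsl (Ioo y b) hg).integral_prod_right
  rw [integral_add h2 h3, ← integral_integral_swap (f := fun x s => g (x, s)) (hsl (Ioo y b) hg), ← h1]
  simp only [Pi.sub_apply]
  rw [integral_sub (hdI.mono_set hsub) (hGI.mono_set hsub)]
  ring

theorem stronglyMeasurable_setIntegral_slice {F : ℝ × ℝ → ℝ} (hF : StronglyMeasurable F)
    {l r : ℝ → ℝ} (hl : Measurable l) (hr : Measurable r) :
    StronglyMeasurable (fun p : ℝ × ℝ => ∫ y in Ioo (l p.1) (r p.1), F (y, p.2)) := by
  have hU : MeasurableSet {z : (ℝ × ℝ) × ℝ | l z.1.1 < z.2 ∧ z.2 < r z.1.1} :=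
    (measurableSet_lt (hl.comp measurable_fst.fst) measurable_snd).inter
      (measurableSet_lt measurable_snd (hr.comp measurable_fst.fst))
  have h : StronglyMeasurable (indicator {z : (ℝ × ℝ) × ℝ | l z.1.1 < z.2 ∧ z.2 < r z.1.1}
      fun z => F (z.2, z.1.2)) :=
    (hF.comp_measurable (by fun_prop)).indicator hU
  convert h.integral_prod_right' (ν := volume) using 2 with p
  rw [← integral_indicator measurableSet_Ioo]
  rfl

theorem exists_measurable_const {a b T : ℝ} (hab : a < b) {w : ℝ → ℝ → ℝ}
    (hw : ContL2 a b (Icc 0 T) w)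
    (hwm : AEStronglyMeasurable (fun p : ℝ × ℝ => w p.1 p.2)
      (volume.restrict (Ioo a b ×ˢ Ioo 0 T)))
    {V : ℝ × ℝ → ℝ} (hVm : StronglyMeasurable V) (hV : MemLp V 2 volume)
    (hrep : ∀ᵐ t ∂volume.restrict (Ioo 0 T), ∃ c, ∀ᵐ x ∂volume.restrict (Ioo a b),
      w x t = c + ∫ y in Ioo a x, V (y, t)) :
    ∃ α : ℝ → ℝ, StronglyMeasurable α ∧ MemLp α 2 volume ∧ (∀ t ∉ Ioo 0 T, α t = 0) ∧
      ∀ᵐ t ∂volume.restrict (Ioo 0 T), ∀ᵐ x ∂volume.restrict (Ioo a b),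
        w x t = α t + ∫ y in Ioo a x, V (y, t) := by
  have hba : 0 < b - a := sub_pos.2 hab
  have hm : AEStronglyMeasurable (fun t => (b - a)⁻¹ *
      ∫ x in Ioo a b, (w x t - ∫ y in Ioo a x, V (y, t))) (volume.restrict (Ioo 0 T)) := by
    have h1 := (stronglyMeasurable_setIntegral_slice hVm (measurable_const (a := a))
      measurable_id).aestronglyMeasurable (μ := volume.restrict (Ioo a b ×ˢ Ioo 0 T))
    have h2 := hwm.sub h1
    rw [Measure.volume_eq_prod, ← Measure.prod_restrict] at h2
    exact (h2.prod_swap.integral_prod_right').const_mul _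
  refine ⟨(Ioo 0 T).indicator (hm.mk _), hm.stronglyMeasurable_mk.indicator measurableSet_Ioo,
    ?_, fun t ht => indicator_of_notMem ht _, ?_⟩
  all_goals
    have hc : ∀ᵐ t ∂volume.restrict (Ioo 0 T), ∀ᵐ x ∂volume.restrict (Ioo a b),
        w x t = hm.mk _ t + ∫ y in Ioo a x, V (y, t) := by
      filter_upwards [hrep, hm.ae_eq_mk] with t ⟨c, hc⟩ h2
      have : hm.mk _ t = c := by
        rw [← h2]
        have e : ∫ x in Ioo a b, (w x t - ∫ y in Ioo a x, V (y, t)) = ∫ x in Ioo a b, c := by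
          refine integral_congr_ae ?_
          filter_upwards [hc] with x hx
          rw [hx]; ring
        rw [e]
        simp [hab.le, hba.ne']
      rw [this]
      exact hc
  · rw [memLp_indicator_iff_restrict measurableSet_Ioo,
      memLp_two_iff_integrable_sq hm.stronglyMeasurable_mk.aestronglyMeasurable]
    have hV2 : Integrable (fun p => V p ^ 2)
        ((volume.restrict (Ioo a b)).prod (volume.restrict (Ioo 0 T))) := by
      rw [Measure.prod_restrict]
      exact hV.integrable_sq.restrict
    have hN : IntegrableOn (fun t => ∫ x in Ioo a b, w x t ^ 2) (Ioo 0 T) :=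
      hw.continuousOn_sq.integrableOn_Icc.mono_set Ioo_subset_Icc_self
    refine Integrable.mono' (((hN.const_mul 2).add (hV2.integral_prod_right.const_mul
      (2 * (b - a) ^ 2))).const_mul (b - a)⁻¹)
      (hm.stronglyMeasurable_mk.aestronglyMeasurable.pow 2) ?_
    filter_upwards [hc, hV2.prod_left_ae, ae_restrict_mem measurableSet_Ioo] with t h1 h2 ht
    have hVt : MemL2 a b (fun y => V (y, t)) :=
      ⟨(hVm.comp_measurable (by fun_prop)).aestronglyMeasurable, h2⟩
    have hwt := hw.1 t (Ioo_subset_Icc_self ht)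
    have h3 : (b - a) * hm.mk _ t ^ 2 ≤ 2 * (∫ x in Ioo a b, w x t ^ 2)
        + 2 * (b - a) * (∫ y in Ioo a b, |V (y, t)|) ^ 2 := by
      calc (b - a) * hm.mk _ t ^ 2 = ∫ x in Ioo a b, hm.mk _ t ^ 2 := by simp [hab.le]
        _ ≤ ∫ x in Ioo a b, (2 * w x t ^ 2 + 2 * (∫ y in Ioo a b, |V (y, t)|) ^ 2) := by
          refine integral_mono_ae (integrable_const _)
            ((hwt.2.const_mul 2).add (integrable_const _)) ?_
          filter_upwards [h1, ae_restrict_mem measurableSet_Ioo] with x hx hxm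
          have h4 : |∫ y in Ioo a x, V (y, t)| ≤ ∫ y in Ioo a b, |V (y, t)| :=
            (abs_integral_le_integral_abs).trans (setIntegral_mono_set hVt.integrableOn.abs
              (Eventually.of_forall fun y => abs_nonneg _)
              (Ioo_subset_Ioo_right hxm.2.le).eventuallyLE)
          have h5 := sq_le_sq' (abs_le.1 h4).1 (abs_le.1 h4).2
          rw [hx]
          nlinarith [sq_nonneg (hm.mk _ t + 2 * ∫ y in Ioo a x, V (y, t))]
        _ = _ := by
          rw [integral_add (hwt.2.const_mul 2) (integrable_const _), integral_const_mul]
          simp [hab.le]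
          ring
    have h6 := sq_integral_le hab.le hVt.memLp
    rw [Real.norm_of_nonneg (sq_nonneg _)]
    simp only [Pi.add_apply]
    rw [← mul_le_mul_iff_right₀ hba, mul_inv_cancel_left₀ hba.ne']
    nlinarith
  · filter_upwards [hc, ae_restrict_mem measurableSet_Ioo] with t h1 h2
    rw [indicator_of_mem h2]
    exact h1

theorem energy_inequality_of_weak {a b T : ℝ} (hab : a < b) (hT : 0 < T) {w : ℝ → ℝ → ℝ}
    {w0 : ℝ → ℝ} (hw : ContL2 a b (Icc 0 T) w)
    (hwm : AEStronglyMeasurable (fun p : ℝ × ℝ => w p.1 p.2)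
      (volume.restrict (Ioo a b ×ˢ Ioo 0 T))) (hw0 : MemL2 a b w0)
    {P g V : ℝ × ℝ → ℝ} (hPm : StronglyMeasurable P) (hgm : StronglyMeasurable g)
    (hVm : StronglyMeasurable V) (hP : MemLp P 2 volume) (hV : MemLp V 2 volume)
    (hg : Integrable g) (hg2 : Integrable (fun s => (∫ x, |g (x, s)|) ^ 2))
    (hP0 : ∀ p ∉ Ioo a b ×ˢ Ioo 0 T, P p = 0) (hg0 : ∀ p ∉ Ioo a b ×ˢ Ioo 0 T, g p = 0)
    (hV0 : ∀ p ∉ Ioo a b ×ˢ Ioo 0 T, V p = 0)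
    (hweak : ∀ ψ η : ℝ → ℝ, ContDiff ℝ (⊤ : ℕ∞) ψ → ContDiff ℝ (⊤ : ℕ∞) η →
      (∃ T' < T, ∀ t, T' ≤ t → η t = 0) →
      -(∫ t in Ioo 0 T, (∫ x in Ioo a b, w x t * ψ x) * deriv η t)
          - (∫ x in Ioo a b, w0 x * ψ x) * η 0
        = ∫ t in Ioo 0 T, (∫ x in Ioo a b, (P (x, t) * deriv ψ x + g (x, t) * ψ x)) * η t)
    (hrep : ∀ᵐ t ∂volume.restrict (Ioo 0 T), ∃ c, ∀ᵐ x ∂volume.restrict (Ioo a b),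
      w x t = c + ∫ y in Ioo a x, V (y, t)) :
    IntegrableOn (fun t => ∫ x in Ioo a b, (P (x, t) * V (x, t) + g (x, t) * w x t)) (Ioo 0 T) ∧
    ∀ τ ∈ Ioo 0 T, (∫ x in Ioo a b, w x τ ^ 2) - ∫ x in Ioo a b, w0 x ^ 2
      ≤ 2 * ∫ t in Ioo 0 τ, ∫ x in Ioo a b, (P (x, t) * V (x, t) + g (x, t) * w x t) := by
  obtain ⟨α, hαm, hα, hα0, hαr⟩ := exists_measurable_const hab hw hwm hVm hV hrep
  have hS : MeasurableSet (Ioo a b ×ˢ Ioo 0 T : Set (ℝ × ℝ)) :=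
    measurableSet_Ioo.prod measurableSet_Ioo
  have hPI : Integrable P := by
    rw [← integrableOn_iff_integrable_of_support_subset (s := Ioo a b ×ˢ Ioo 0 T)
      (fun p hp => by by_contra h; exact hp (hP0 p h))]
    have : IsFiniteMeasure (volume.restrict (Ioo a b ×ˢ Ioo 0 T : Set (ℝ × ℝ))) :=
      ⟨by simpa using (isBounded_Ioo_prod a b 0 T).measure_lt_top⟩
    exact (hP.restrict _).integrable one_le_two
  -- the potential and the extended derivative
  set A := a - 1 with hA
  have hAa : A ≤ a := by linarith
  set R : ℝ × ℝ → ℝ := (Ioo A b ×ˢ univ).indicator fun p => ∫ x in Ioo p.1 b, g (x, p.2) with hR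
  have hSA : MeasurableSet (Ioo A b ×ˢ univ : Set (ℝ × ℝ)) := measurableSet_Ioo.prod .univ
  have hRm : StronglyMeasurable R :=
    (stronglyMeasurable_setIntegral_slice hgm measurable_id measurable_const).indicator hSA
  have hRL : MemLp R 2 volume := by
    rw [memLp_two_iff_integrable_sq hRm.aestronglyMeasurable]
    have h1 : Integrable ((Ioo A b).indicator (fun _ : ℝ => (1 : ℝ))) :=
      (integrable_indicator_iff measurableSet_Ioo).2 (integrableOn_const (by simp))
    refine (h1.mul_prod hg2).mono' (hRm.aestronglyMeasurable.pow 2) ?_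
    have hgs : ∀ᵐ p : ℝ × ℝ, Integrable fun x => g (x, p.2) :=
      Measure.quasiMeasurePreserving_snd.ae (hg.prod_left_ae)
    filter_upwards [hgs] with p hp
    rw [Real.norm_of_nonneg (sq_nonneg _)]
    by_cases hpA : p.1 ∈ Ioo A b
    · have : p ∈ (Ioo A b ×ˢ univ : Set (ℝ × ℝ)) := ⟨hpA, mem_univ _⟩
      rw [hR, indicator_of_mem this, indicator_of_mem hpA, one_mul]
      refine sq_le_sq' (neg_le_of_abs_le ?_) (le_of_abs_le ?_) <;>
      exact (abs_integral_le_integral_abs).trans (setIntegral_le_integral hp.abs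
        (Eventually.of_forall fun y => abs_nonneg _))
    · have : p ∉ (Ioo A b ×ˢ univ : Set (ℝ × ℝ)) := fun h => hpA h.1
      rw [hR, indicator_of_notMem this, indicator_of_notMem hpA]
      simp
  set Q : ℝ × ℝ → ℝ := fun p => P p + R p with hQ
  have hQm : StronglyMeasurable Q := hPm.add hRm
  have hQL : MemLp Q 2 volume := hP.add hRL
  set W : ℝ × ℝ → ℝ := fun p => V p + (Ioc A a).indicator (fun _ => (1 : ℝ)) p.1 * α p.2 with hW
  have h1m : StronglyMeasurable ((Ioc A a).indicator (fun _ : ℝ => (1 : ℝ))) :=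
    stronglyMeasurable_const.indicator measurableSet_Ioc
  have hcm : StronglyMeasurable fun p : ℝ × ℝ => (Ioc A a).indicator (fun _ => (1 : ℝ)) p.1 * α p.2 :=
    (h1m.comp_measurable measurable_fst).mul (hαm.comp_measurable measurable_snd)
  have hWm : StronglyMeasurable W := hVm.add hcm
  have hWL : MemLp W 2 volume := by
    refine hV.add ((memLp_two_iff_integrable_sq hcm.aestronglyMeasurable).2 ?_)
    have h1 : Integrable ((Ioc A a).indicator (fun _ : ℝ => (1 : ℝ))) :=
      (integrable_indicator_iff measurableSet_Ioc).2 (integrableOn_const (by simp))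
    refine (h1.mul_prod hα.integrable_sq).congr (Eventually.of_forall fun p => ?_)
    simp only [indicator]
    split_ifs <;> ring
  have hQy : ∀ y ∈ Ioo A b, ∀ s, Q (y, s) = P (y, s) + ∫ x in Ioo y b, g (x, s) := by
    intro y hy s
    have hm : (y, s) ∈ (Ioo A b ×ˢ univ : Set (ℝ × ℝ)) := ⟨hy, mem_univ _⟩
    simp only [hQ, hR]
    rw [indicator_of_mem hm]
  have hQ0 : ∀ y s, y ∉ Ioo A b → Q (y, s) = 0 := by
    intro y s hy
    simp only [hQ, hR]
    rw [indicator_of_notMem (fun h : (y, s) ∈ (Ioo A b ×ˢ univ : Set (ℝ × ℝ)) => hy h.1),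
      hP0 _ fun h => hy ⟨hAa.trans_lt h.1.1, h.1.2⟩, add_zero]
  have hQ1 : ∀ y s, s ≤ 0 → Q (y, s) = 0 := by
    intro y s hs
    have h0 : ∀ x, g (x, s) = 0 := fun x => hg0 _ fun h => hs.not_gt h.2.1
    by_cases hy : y ∈ Ioo A b
    · simp [hQy y hy, h0, hP0 (y, s) fun h => hs.not_gt h.2.1]
    · exact hQ0 y s hy
  have hrepW : ∀ᵐ t ∂volume.restrict (Ioo 0 T), ∀ᵐ x ∂volume.restrict (Ioo a b),
      w x t = ∫ y in Ioo A x, W (y, t) := by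
    filter_upwards [hαr, ae_restrict_of_ae hV.integrable_sq.prod_left_ae] with t h1 h2
    filter_upwards [h1, ae_restrict_mem measurableSet_Ioo] with x hx hxm
    have hVI : IntegrableOn (fun y => V (y, t)) (Ioo A x) :=
      (((memLp_two_iff_integrable_sq (hVm.comp_measurable (by fun_prop)).aestronglyMeasurable).2
        h2).restrict _).integrable one_le_two
    have h1I : Integrable ((Ioc A a).indicator (fun _ : ℝ => (1 : ℝ))) :=
      (integrable_indicator_iff measurableSet_Ioc).2 (integrableOn_const (by simp))
    have e1 : ∫ y in Ioo A x, V (y, t) = ∫ y in Ioo a x, V (y, t) :=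
      setIntegral_eq_of_subset_of_forall_sdiff_eq_zero measurableSet_Ioo
        (Ioo_subset_Ioo_left hAa) fun y hy => hV0 _ fun h => hy.2 ⟨h.1.1, hy.1.2⟩
    have e2 : ∫ y in Ioo A x, (Ioc A a).indicator (fun _ : ℝ => (1 : ℝ)) y = 1 := by
      rw [setIntegral_indicator measurableSet_Ioc, inter_eq_right.2 (show Ioc A a ⊆ Ioo A x from
        fun y hy => ⟨hy.1, hy.2.trans_lt hxm.1⟩)]
      simp [hA]
    simp only [hW]
    rw [integral_add hVI (h1I.integrableOn.mul_const _), integral_mul_const, e1, e2, hx]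
    ring
  have hslice : ∀ᵐ t ∂volume.restrict (Ioo 0 T), ∫ y, Q (y, t) * W (y, t)
      = ∫ x in Ioo a b, (P (x, t) * V (x, t) + g (x, t) * w x t) := by
    filter_upwards [hrepW, ae_restrict_of_ae hWL.integrable_sq.prod_left_ae,
      ae_restrict_of_ae (hP.integrable_mul hWL).prod_left_ae,
      ae_restrict_of_ae (hRL.integrable_mul hWL).prod_left_ae,
      ae_restrict_of_ae hg.prod_left_ae] with t h1 h2 h3 h4 h5
    have hWI : IntegrableOn (fun y => W (y, t)) (Ioo A b) :=
      (((memLp_two_iff_integrable_sq (hWm.comp_measurable (by fun_prop)).aestronglyMeasurable).2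
        h2).restrict _).integrable one_le_two
    simp only [Pi.mul_apply] at h3 h4 h5
    have eW : ∀ x ∈ Ioo a b, W (x, t) = V (x, t) := by
      intro x hx
      simp only [hW]
      rw [indicator_of_notMem (fun h => h.2.not_gt hx.1), zero_mul, add_zero]
    have iPV : IntegrableOn (fun x => P (x, t) * V (x, t)) (Ioo a b) :=
      h3.integrableOn.congr_fun (fun x hx => by simp only [eW x hx]) measurableSet_Ioo
    have igw : IntegrableOn (fun x => g (x, t) * w x t) (Ioo a b) := by
      have : IntegrableOn (fun x => g (x, t) * ∫ y in Ioo A x, W (y, t)) (Ioo a b) :=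
        h5.integrableOn.mul_continuousOn_of_subset (continuousOn_primitive_Ioo hWI)
          measurableSet_Ioo isCompact_Icc
          ((Ioo_subset_Ioo_left hAa).trans Ioo_subset_Icc_self)
      refine this.congr ?_
      filter_upwards [h1] with x hx
      rw [hx]
    have ePW : ∫ y, P (y, t) * W (y, t) = ∫ x in Ioo a b, P (x, t) * V (x, t) := by
      rw [← setIntegral_congr_fun measurableSet_Ioo fun x hx =>
        show P (x, t) * W (x, t) = P (x, t) * V (x, t) by rw [eW x hx]]
      exact (setIntegral_eq_integral_of_forall_compl_eq_zero fun x hx => by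
        simp [hP0 (x, t) fun h => hx h.1]).symm
    have eRW : ∫ y, R (y, t) * W (y, t) = ∫ x in Ioo a b, g (x, t) * w x t := by
      calc ∫ y, R (y, t) * W (y, t)
          = ∫ y in Ioo A b, W (y, t) * ∫ x in Ioo y b, g (x, t) := by
            refine Eq.trans (setIntegral_eq_integral_of_forall_compl_eq_zero
              (s := Ioo A b) fun y hy => ?_).symm
              (setIntegral_congr_fun measurableSet_Ioo fun y hy => ?_)
            · have hm : (y, t) ∉ (Ioo A b ×ˢ univ : Set (ℝ × ℝ)) := fun h => hy h.1
              simp only [hR]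
              rw [indicator_of_notMem hm, zero_mul]
            · have hm : (y, t) ∈ (Ioo A b ×ˢ univ : Set (ℝ × ℝ)) := ⟨hy, mem_univ _⟩
              simp only [hR]
              rw [indicator_of_mem hm, mul_comm]
        _ = ∫ x in Ioo A b, g (x, t) * ∫ y in Ioo A x, W (y, t) :=
            (integral_mul_primitive h5.integrableOn hWI).symm
        _ = ∫ x in Ioo a b, g (x, t) * ∫ y in Ioo A x, W (y, t) :=
            setIntegral_eq_of_subset_of_forall_sdiff_eq_zero measurableSet_Ioo
              (Ioo_subset_Ioo_left hAa) fun x hx => by simp [hg0 (x, t) fun h => hx.2 h.1]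
        _ = _ := by
            refine integral_congr_ae ?_
            filter_upwards [h1] with x hx
            rw [hx]
    rw [integral_add iPV igw, ← ePW, ← eRW, ← integral_add h3 h4]
    simp only [hQ, add_mul]
  have hint : IntegrableOn (fun t => ∫ y, Q (y, t) * W (y, t)) (Ioo 0 T) :=
    (hQL.integrable_mul hWL).integral_prod_right.integrableOn
  refine ⟨hint.congr hslice, fun τ hτ => ?_⟩
  have hτT : Ioo 0 τ ⊆ Ioo 0 T := Ioo_subset_Ioo_right hτ.2.le
  rw [← integral_congr_ae (ae_restrict_of_ae_restrict_of_subset hτT hslice)]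
  refine energy_inequality_of_potential hAa hτ.1
    (hw.continuousOn_sq.mono (Icc_subset_Icc_right hτ.2.le))
    (fun t ht => hw.1 t (Icc_subset_Icc_right hτ.2.le ht)) hw0 hQm hWm hQL hWL hQ0 hQ1 ?_
    (ae_restrict_of_ae_restrict_of_subset hτT hrepW)
  intro t ht
  have htT : t ∈ Ioo 0 T := hτT ht
  have := potential_of_weak (A := A) (T := T) (t := t) hAa
    ((hw.1 t (Ioo_subset_Icc_self htT)).sub hw0).integrableOn hPI hg hP0 hg0 (by
      intro ψ hψ
      have hψ2 := memLp_two_of_continuous a b hψ.continuous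
      have hF : IntegrableOn (fun s => ∫ x in Ioo a b, (P (x, s) * deriv ψ x + g (x, s) * ψ x))
          (Ioo 0 T) := by
        have h1 := (Integrable.mul_continuous_of_bounded hS (isBounded_Ioo_prod a b 0 T) hPI hP0
          ((hψ.continuous_deriv (by simp)).comp continuous_fst)).add
          (Integrable.mul_continuous_of_bounded hS (isBounded_Ioo_prod a b 0 T) hg hg0
            (hψ.continuous.comp continuous_fst))
        have h2 := h1.restrict (s := Ioo a b ×ˢ Ioo 0 T)
        rw [Measure.volume_eq_prod, ← Measure.prod_restrict] at h2
        exact h2.integral_prod_right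
      have := sub_eq_integral_of_weak hT (hw.continuousOn_integral_mul hψ2) hF
        (fun η => hweak ψ η hψ) t htT
      rw [← this, ← integral_sub]
      · simp only [sub_mul]
      · exact (hw.1 t (Ioo_subset_Icc_self htT)).memLp.integrable_mul hψ2
      · exact hw0.memLp.integrable_mul hψ2)
  filter_upwards [this, ae_restrict_mem measurableSet_Ioo] with y hy hyA
  rw [hy]
  simp only [hQy y hyA]

theorem volume_restrict_prod (U V : Set ℝ) :
    (volume.restrict (U ×ˢ V) : Measure (ℝ × ℝ)) = (volume.restrict U).prod (volume.restrict V) := by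
  rw [Measure.prod_restrict]; rfl

theorem ae_slice_of_ae_prod {a b c d : ℝ} {p : ℝ × ℝ → Prop}
    (h : ∀ᵐ z ∂volume.restrict (Ioo a b ×ˢ Ioo c d), p z) :
    ∀ᵐ t ∂volume.restrict (Ioo c d), ∀ᵐ x ∂volume.restrict (Ioo a b), p (x, t) := by
  rw [volume_restrict_prod] at h
  exact Measure.ae_ae_of_ae_prod (p := fun z => p z.swap)
    (Measure.measurePreserving_swap.quasiMeasurePreserving.ae h)

theorem exists_stronglyMeasurable_extension {a b T : ℝ} {F : ℝ → ℝ → ℝ}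
    (hF : AEStronglyMeasurable (fun p : ℝ × ℝ => F p.1 p.2)
      (volume.restrict (Ioo a b ×ˢ Ioo 0 T))) :
    ∃ G : ℝ × ℝ → ℝ, StronglyMeasurable G ∧ (∀ p ∉ Ioo a b ×ˢ Ioo 0 T, G p = 0) ∧
      ((fun p : ℝ × ℝ => F p.1 p.2) =ᵐ[volume.restrict (Ioo a b ×ˢ Ioo 0 T)] G) ∧
      ∀ᵐ t ∂volume.restrict (Ioo 0 T), ∀ᵐ x ∂volume.restrict (Ioo a b), F x t = G (x, t) := by
  have hS : MeasurableSet (Ioo a b ×ˢ Ioo 0 T : Set (ℝ × ℝ)) :=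
    measurableSet_Ioo.prod measurableSet_Ioo
  have h : (fun p : ℝ × ℝ => F p.1 p.2) =ᵐ[volume.restrict (Ioo a b ×ˢ Ioo 0 T)]
      (Ioo a b ×ˢ Ioo 0 T).indicator (hF.mk _) := by
    filter_upwards [hF.ae_eq_mk, ae_restrict_mem hS] with p h1 h2
    rw [indicator_of_mem h2, h1]
  exact ⟨_, hF.stronglyMeasurable_mk.indicator hS, fun p hp => indicator_of_notMem hp _, h,
    ae_slice_of_ae_prod h⟩

theorem integrable_of_integrableOn_of_zero {S : Set (ℝ × ℝ)} {F : ℝ × ℝ → ℝ} (h : IntegrableOn F S)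
    (h0 : ∀ p ∉ S, F p = 0) : Integrable F :=
  (integrableOn_iff_integrable_of_support_subset
    fun p hp => by by_contra h'; exact hp (h0 p h')).1 h

theorem setIntegral_prod_mul_eq {a b T : ℝ} {F : ℝ × ℝ → ℝ}
    (hF : IntegrableOn F (Ioo a b ×ˢ Ioo 0 T)) {ψ η : ℝ → ℝ} (hψ : Continuous ψ)
    (hη : Continuous η) :
    IntegrableOn (fun t => (∫ x in Ioo a b, F (x, t) * ψ x) * η t) (Ioo 0 T) ∧
    ∫ p in Ioo a b ×ˢ Ioo 0 T, F p * (ψ p.1 * η p.2)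
      = ∫ t in Ioo 0 T, (∫ x in Ioo a b, F (x, t) * ψ x) * η t := by
  have h := Integrable.mul_bounded_on (measurableSet_Ioo.prod measurableSet_Ioo) hF
    (φ := fun p => ψ p.1 * η p.2) (by fun_prop) (isBounded_Ioo_prod a b 0 T)
  rw [IntegrableOn, volume_restrict_prod] at h
  simp only [← integral_mul_const, mul_assoc]
  exact ⟨h.integral_prod_right, by rw [volume_restrict_prod, integral_prod_symm _ h]⟩

theorem energy_inequality {a b T : ℝ} (hab : a < b) (hT : 0 < T) {w P g V : ℝ → ℝ → ℝ}
    {w0 H : ℝ → ℝ} (hw : ContL2 a b (Icc 0 T) w)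
    (hwI : IntegrableOn (fun p : ℝ × ℝ => w p.1 p.2) (Ioo a b ×ˢ Ioo 0 T)) (hw0 : MemL2 a b w0)
    (hP : MemLp (fun p : ℝ × ℝ => P p.1 p.2) 2 (volume.restrict (Ioo a b ×ˢ Ioo 0 T)))
    (hV : MemLp (fun p : ℝ × ℝ => V p.1 p.2) 2 (volume.restrict (Ioo a b ×ˢ Ioo 0 T)))
    (hg : IntegrableOn (fun p : ℝ × ℝ => g p.1 p.2) (Ioo a b ×ˢ Ioo 0 T))
    (hH : IntegrableOn H (Ioo 0 T))
    (hgH : ∀ᵐ t ∂volume.restrict (Ioo 0 T), (∫ x in Ioo a b, |g x t|) ^ 2 ≤ H t)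
    (hweak : ∀ ψ η : ℝ → ℝ, ContDiff ℝ (⊤ : ℕ∞) ψ → ContDiff ℝ (⊤ : ℕ∞) η →
      (∃ T' < T, ∀ t, T' ≤ t → η t = 0) →
      -(∫ p in Ioo a b ×ˢ Ioo 0 T, w p.1 p.2 * (ψ p.1 * deriv η p.2))
          - (∫ x in Ioo a b, w0 x * (ψ x * η 0))
        = (∫ p in Ioo a b ×ˢ Ioo 0 T, P p.1 p.2 * (deriv ψ p.1 * η p.2))
          + ∫ p in Ioo a b ×ˢ Ioo 0 T, g p.1 p.2 * (ψ p.1 * η p.2))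
    (hrep : ∀ᵐ t ∂volume.restrict (Ioo 0 T), WeakDerivI a b (fun x => w x t) (fun x => V x t)) :
    IntegrableOn (fun t => ∫ x in Ioo a b, (P x t * V x t + g x t * w x t)) (Ioo 0 T) ∧
    ∀ τ ∈ Ioo 0 T, (∫ x in Ioo a b, w x τ ^ 2) - ∫ x in Ioo a b, w0 x ^ 2
      ≤ 2 * ∫ t in Ioo 0 τ, ∫ x in Ioo a b, (P x t * V x t + g x t * w x t) := by
  have hS : MeasurableSet (Ioo a b ×ˢ Ioo 0 T : Set (ℝ × ℝ)) :=
    measurableSet_Ioo.prod measurableSet_Ioo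
  obtain ⟨P1, hP1m, hP10, hP1e, hP1s⟩ := exists_stronglyMeasurable_extension hP.1
  obtain ⟨g1, hg1m, hg10, hg1e, hg1s⟩ := exists_stronglyMeasurable_extension hg.1
  obtain ⟨V1, hV1m, hV10, hV1e, hV1s⟩ := exists_stronglyMeasurable_extension hV.1
  have hL : ∀ {F : ℝ → ℝ → ℝ} {G : ℝ × ℝ → ℝ}, StronglyMeasurable G →
      (∀ p ∉ Ioo a b ×ˢ Ioo 0 T, G p = 0) →
      ((fun p : ℝ × ℝ => F p.1 p.2) =ᵐ[volume.restrict (Ioo a b ×ˢ Ioo 0 T)] G) →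
      MemLp (fun p : ℝ × ℝ => F p.1 p.2) 2 (volume.restrict (Ioo a b ×ˢ Ioo 0 T)) →
      MemLp G 2 volume := by
    intro F G h1 h2 h3 h4
    rw [memLp_two_iff_integrable_sq h1.aestronglyMeasurable]
    exact integrable_of_integrableOn_of_zero ((memLp_congr_ae h3).1 h4).integrable_sq
      fun p hp => by simp [h2 p hp]
  have hP1 := hL hP1m hP10 hP1e hP
  have hV1 := hL hV1m hV10 hV1e hV
  have hg1 : Integrable g1 := integrable_of_integrableOn_of_zero (hg.congr hg1e) hg10
  have : IsFiniteMeasure (volume.restrict (Ioo a b ×ˢ Ioo 0 T : Set (ℝ × ℝ))) :=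
    ⟨by simpa using (isBounded_Ioo_prod a b 0 T).measure_lt_top⟩
  have hP1I : IntegrableOn P1 (Ioo a b ×ˢ Ioo 0 T) := (hP1.restrict _).integrable one_le_two
  have hg1sq : Integrable (fun s => (∫ x, |g1 (x, s)|) ^ 2) := by
    have hsupp : support (fun s => (∫ x, |g1 (x, s)|) ^ 2) ⊆ Ioo 0 T := by
      intro s hs
      by_contra h
      simp [hg10 (_, s) fun h' => h h'.2] at hs
    rw [← integrableOn_iff_integrable_of_support_subset hsupp]
    refine hH.mono' ((hg1.abs.integral_prod_right.1.pow 2).restrict) ?_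
    filter_upwards [hgH, hg1s] with s h1 h2
    rw [Real.norm_of_nonneg (sq_nonneg _)]
    refine le_of_eq_of_le ?_ h1
    rw [← setIntegral_eq_integral_of_forall_compl_eq_zero (s := Ioo a b) fun x hx => by
      simp [hg10 (x, s) fun h => hx h.1]]
    congr 1
    refine integral_congr_ae ?_
    filter_upwards [h2] with x hx
    rw [hx]
  have hslice : ∀ᵐ t ∂volume.restrict (Ioo 0 T),
      ∫ x in Ioo a b, (P1 (x, t) * V1 (x, t) + g1 (x, t) * w x t)
        = ∫ x in Ioo a b, (P x t * V x t + g x t * w x t) := by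
    filter_upwards [hP1s, hV1s, hg1s] with t h1 h2 h3
    refine integral_congr_ae ?_
    filter_upwards [h1, h2, h3] with x e1 e2 e3
    rw [e1, e2, e3]
  obtain ⟨hI, hE⟩ := energy_inequality_of_weak hab hT hw hwI.1 hw0 hP1m hg1m hV1m hP1 hV1 hg1
    hg1sq hP10 hg10 hV10 (by
      intro ψ η hψ hη hη0
      have hψ' : Continuous (deriv ψ) := hψ.continuous_deriv (by simp)
      have hη' : Continuous (deriv η) := hη.continuous_deriv (by simp)
      have h := hweak ψ η hψ hη hη0
      have eP : ∫ p in Ioo a b ×ˢ Ioo 0 T, P p.1 p.2 * (deriv ψ p.1 * η p.2)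
          = ∫ p in Ioo a b ×ˢ Ioo 0 T, P1 p * (deriv ψ p.1 * η p.2) :=
        integral_congr_ae (hP1e.mul EventuallyEq.rfl)
      have eg : ∫ p in Ioo a b ×ˢ Ioo 0 T, g p.1 p.2 * (ψ p.1 * η p.2)
          = ∫ p in Ioo a b ×ˢ Ioo 0 T, g1 p * (ψ p.1 * η p.2) :=
        integral_congr_ae (hg1e.mul EventuallyEq.rfl)
      obtain ⟨i1, e1⟩ := setIntegral_prod_mul_eq hP1I hψ' hη.continuous
      obtain ⟨i2, e2⟩ := setIntegral_prod_mul_eq hg1.integrableOn hψ.continuous hη.continuous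
      rw [eP, eg, (setIntegral_prod_mul_eq hwI hψ.continuous hη').2, e1, e2,
        ← integral_add i1 i2] at h
      have e3 : ∫ x in Ioo a b, w0 x * (ψ x * η 0) = (∫ x in Ioo a b, w0 x * ψ x) * η 0 := by
        simp only [← integral_mul_const, mul_assoc]
      rw [← e3, h]
      refine integral_congr_ae ?_
      have j1 := Integrable.mul_bounded_on hS hP1I (φ := fun p => deriv ψ p.1) (by fun_prop)
        (isBounded_Ioo_prod a b 0 T)
      have j2 := Integrable.mul_bounded_on hS hg1.integrableOn (φ := fun p => ψ p.1)
        (hψ.continuous.comp continuous_fst) (isBounded_Ioo_prod a b 0 T)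
      rw [IntegrableOn, volume_restrict_prod] at j1 j2
      filter_upwards [j1.prod_left_ae, j2.prod_left_ae] with t k1 k2
      rw [integral_add k1 k2]
      ring) (by
      have hVI : IntegrableOn V1 (Ioo a b ×ˢ Ioo 0 T) := (hV1.restrict _).integrable one_le_two
      rw [IntegrableOn, volume_restrict_prod] at hVI
      filter_upwards [hrep, hV1s, hVI.prod_left_ae, ae_restrict_mem measurableSet_Ioo]
        with t h1 h2 h3 ht
      obtain ⟨c, hc⟩ := WeakDerivI.exists_eq_primitive hab
        (hw.1 t (Ioo_subset_Icc_self ht)).integrableOn (h3.congr (EventuallyEq.symm h2)) h1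
      refine ⟨c, ?_⟩
      filter_upwards [hc, ae_restrict_mem measurableSet_Ioo] with x hx hxm
      rw [hx]
      congr 1
      exact integral_congr_ae (ae_restrict_of_ae_restrict_of_subset
        (Ioo_subset_Ioo_right hxm.2.le) h2))
  refine ⟨hI.congr hslice, fun τ hτ => (hE τ hτ).trans_eq ?_⟩
  rw [integral_congr_ae (ae_restrict_of_ae_restrict_of_subset
    (Ioo_subset_Ioo_right hτ.2.le) hslice)]

theorem HypF.exists_bounds {f f' f'' : ℝ → ℝ} (hf : HypF f f' f'') :
    ∃ M > 0, (∀ x, 0 ≤ x → |f' x| ≤ M) ∧ (∀ x y, 0 ≤ x → 0 ≤ y → |f x - f y| ≤ M * |x - y|) ∧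
      (∀ x y, 0 ≤ x → 0 ≤ y → |f' x - f' y| ≤ M * |x - y|) ∧ ∀ x, 0 ≤ x → |f x| ≤ M * |x| := by
  obtain ⟨M, hM⟩ := hf.bdd
  have hM0 : 0 < M := (abs_pos.2 (hf.pos 0 self_mem_Ici).ne').trans_le (hM 0 self_mem_Ici).1
  have h1 : ∀ x y, 0 ≤ x → 0 ≤ y → |f x - f y| ≤ M * |x - y| := fun x y hx hy =>
    (convex_Ici 0).norm_image_sub_le_of_norm_hasDerivWithin_le hf.hasDeriv₁
      (fun z hz => (hM z hz).1) hy hx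
  refine ⟨M, hM0, fun x hx => (hM x hx).1, h1, fun x y hx hy =>
    (convex_Ici 0).norm_image_sub_le_of_norm_hasDerivWithin_le hf.hasDeriv₂
      (fun z hz => (hM z hz).2) hy hx, fun x hx => ?_⟩
  simpa [hf.zero] using h1 x 0 hx le_rfl

theorem WeakDerivI.ae_abs_le {a b ℓ : ℝ} (hab : a < b) (hℓ : 0 < ℓ) (hℓb : ℓ ≤ b - a)
    {θ v : ℝ → ℝ} (hθ : IntegrableOn θ (Ioo a b)) (hv : IntegrableOn v (Ioo a b))
    (h : WeakDerivI a b θ v) :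
    ∀ᵐ x ∂volume.restrict (Ioo a b), ∃ c, a ≤ c ∧ c + ℓ ≤ b ∧
      |θ x| ≤ ℓ⁻¹ * (∫ z in Ioo c (c + ℓ), |θ z|) + ∫ z in Ioo c (c + ℓ), |v z| := by
  obtain ⟨k, hk⟩ := h.exists_eq_primitive hab hθ hv
  filter_upwards [hk, ae_restrict_mem measurableSet_Ioo] with x hx hxm
  obtain ⟨c, hac, hcb, hcx, hxc⟩ : ∃ c, a ≤ c ∧ c + ℓ ≤ b ∧ c ≤ x ∧ x ≤ c + ℓ := by
    by_cases hc : x - ℓ ≤ a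
    · exact ⟨a, le_rfl, by linarith, hxm.1.le, by linarith⟩
    · exact ⟨x - ℓ, (not_le.1 hc).le, by linarith [hxm.2], by linarith, by linarith⟩
  refine ⟨c, hac, hcb, ?_⟩
  have hsub : Ioo c (c + ℓ) ⊆ Ioo a b := Ioo_subset_Ioo hac hcb
  have hp : ∀ z ∈ Ioo c (c + ℓ), |(∫ y in Ioo a x, v y) - ∫ y in Ioo a z, v y|
      ≤ ∫ z in Ioo c (c + ℓ), |v z| := by
    intro z hz
    have hI : ∀ {y}, y ∈ Icc a b → IntervalIntegrable v volume a y := fun hy =>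
      (intervalIntegrable_iff_integrableOn_Ioo_of_le hy.1).2
        (hv.mono_set (Ioo_subset_Ioo_right hy.2))
    have hzI : z ∈ Icc a b := Ioo_subset_Icc_self (hsub hz)
    have e := intervalIntegral.integral_interval_sub_left (hI (Ioo_subset_Icc_self hxm)) (hI hzI)
    simp only [intervalIntegral.integral_of_le hxm.1.le, intervalIntegral.integral_of_le hzI.1,
      integral_Ioc_eq_integral_Ioo] at e
    rw [e, ← Real.norm_eq_abs]
    refine intervalIntegral.norm_integral_le_integral_norm_uIoc.trans ?_
    rw [← integral_Ioc_eq_integral_Ioo]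
    have hs : uIoc z x ⊆ Ioc c (c + ℓ) := by
      rw [uIoc]
      exact Ioc_subset_Ioc (le_min hz.1.le hcx) (max_le hz.2.le hxc)
    refine setIntegral_mono_set ?_ (Eventually.of_forall fun y => abs_nonneg _) hs.eventuallyLE
    rw [integrableOn_Ioc_iff_integrableOn_Ioo]
    exact (hv.mono_set hsub).abs
  have key : ∫ z in Ioo c (c + ℓ), |θ x|
      ≤ ∫ z in Ioo c (c + ℓ), (|θ z| + ∫ z in Ioo c (c + ℓ), |v z|) := by
    refine integral_mono_ae (integrable_const _)
      ((hθ.mono_set hsub).abs.add (integrable_const _)) ?_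
    filter_upwards [ae_restrict_of_ae_restrict_of_subset hsub hk,
      ae_restrict_mem measurableSet_Ioo] with z hz hzm
    have h1 := hp z hzm
    have h2 : θ x - θ z = (∫ y in Ioo a x, v y) - ∫ y in Ioo a z, v y := by
      rw [hx, hz]; ring
    rw [← h2] at h1
    linarith [abs_sub_abs_le_abs_sub (θ x) (θ z)]
  rw [integral_add (hθ.mono_set hsub).abs (integrable_const _)] at key
  simp only [integral_const, MeasurableSet.univ, measureReal_restrict_apply, univ_inter,
    Real.volume_real_Ioo_of_le (show c ≤ c + ℓ by linarith), add_sub_cancel_left, smul_eq_mul] at key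
  rw [← mul_le_mul_iff_right₀ hℓ, mul_add, mul_inv_cancel_left₀ hℓ.ne']
  exact key

theorem WeakDerivI.ae_sq_le {a b ℓ : ℝ} (hab : a < b) (hℓ : 0 < ℓ) (hℓb : ℓ ≤ b - a)
    {θ v : ℝ → ℝ} (hθ : MemL2 a b θ) (hv : MemL2 a b v) (h : WeakDerivI a b θ v) :
    ∀ᵐ x ∂volume.restrict (Ioo a b),
      θ x ^ 2 ≤ 2 * ℓ⁻¹ * (∫ z in Ioo a b, θ z ^ 2) + 2 * ℓ * ∫ z in Ioo a b, v z ^ 2 := by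
  filter_upwards [h.ae_abs_le hab hℓ hℓb hθ.integrableOn hv.integrableOn] with x ⟨c, h1, h2, h3⟩
  have hsub : Ioo c (c + ℓ) ⊆ Ioo a b := Ioo_subset_Ioo h1 h2
  have hμ : volume.restrict (Ioo c (c + ℓ)) ≤ volume.restrict (Ioo a b) :=
    Measure.restrict_mono hsub le_rfl
  have aux : ∀ {u : ℝ → ℝ}, MemL2 a b u →
      (∫ z in Ioo c (c + ℓ), |u z|) ^ 2 ≤ ℓ * ∫ z in Ioo a b, u z ^ 2 := by
    intro u hu
    refine (sq_integral_le (by linarith) (hu.memLp.mono_measure hμ)).trans ?_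
    rw [add_sub_cancel_left]
    exact mul_le_mul_of_nonneg_left (setIntegral_mono_set hu.2
      (Eventually.of_forall fun z => sq_nonneg _) hsub.eventuallyLE) hℓ.le
  have h4 := aux hθ
  have h5 := aux hv
  have h6 : θ x ^ 2 ≤ (ℓ⁻¹ * (∫ z in Ioo c (c + ℓ), |θ z|) + ∫ z in Ioo c (c + ℓ), |v z|) ^ 2 := by
    rw [← sq_abs]
    exact pow_le_pow_left₀ (abs_nonneg _) h3 2
  have h7 : (ℓ⁻¹ * (∫ z in Ioo c (c + ℓ), |θ z|)) ^ 2 ≤ ℓ⁻¹ * ∫ z in Ioo a b, θ z ^ 2 := by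
    rw [mul_pow]
    calc ℓ⁻¹ ^ 2 * (∫ z in Ioo c (c + ℓ), |θ z|) ^ 2 ≤ ℓ⁻¹ ^ 2 * (ℓ * ∫ z in Ioo a b, θ z ^ 2) := by
          gcongr
      _ = _ := by field_simp
  nlinarith [sq_nonneg (ℓ⁻¹ * (∫ z in Ioo c (c + ℓ), |θ z|) - ∫ z in Ioo c (c + ℓ), |v z|)]

theorem abs_flux_add_source_le {F Fh d dh v vh p q w M β S C : ℝ} (hM : 0 < M) (hβ : 0 < β)
    (h1 : |F - Fh| ≤ M * |w|) (h2 : |d - dh| ≤ M * |w|) (h3 : |d| ≤ M) (h4 : |dh| ≤ M)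
    (h5 : F ^ 2 ≤ M ^ 2 * C * β ^ 2) (h6 : w ^ 2 ≤ S) :
    |(F * p - Fh * q) * (v - vh) + (d * v * p - dh * vh * q) * w|
      ≤ (v - vh) ^ 2 / 4 + (2 * M ^ 2 * C + M ^ 2 / 4) * β ^ 2 * (p - q) ^ 2
        + (8 * M ^ 2 * S + M * S * β / 2) * q ^ 2
        + (S * β⁻¹ ^ 2 + M * S * β⁻¹ / 2) * v ^ 2 := by
  have e : (F * p - Fh * q) * (v - vh) + (d * v * p - dh * vh * q) * w
      = F * (p - q) * (v - vh) + ((F - Fh) * q * (v - vh) + dh * (v - vh) * q * w)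
        + d * v * (p - q) * w + (d - dh) * v * q * w := by ring
  have t1 : |F * (p - q) * (v - vh)| ≤ (v - vh) ^ 2 / 8 + 2 * M ^ 2 * C * β ^ 2 * (p - q) ^ 2 := by
    have : |F * (p - q) * (v - vh)| ≤ (v - vh) ^ 2 / 8 + 2 * (F ^ 2 * (p - q) ^ 2) := by
      rw [abs_le]
      constructor <;> nlinarith [sq_nonneg ((v - vh) + 4 * (F * (p - q))),
        sq_nonneg ((v - vh) - 4 * (F * (p - q)))]
    nlinarith [mul_le_mul_of_nonneg_right h5 (sq_nonneg (p - q))]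
  have t2 : |(F - Fh) * q * (v - vh) + dh * (v - vh) * q * w|
      ≤ (v - vh) ^ 2 / 8 + 8 * M ^ 2 * S * q ^ 2 := by
    calc |(F - Fh) * q * (v - vh) + dh * (v - vh) * q * w|
        ≤ |(F - Fh) * q * (v - vh)| + |dh * (v - vh) * q * w| := abs_add_le _ _
      _ = |F - Fh| * |q| * |v - vh| + |dh| * |v - vh| * |q| * |w| := by simp only [abs_mul]
      _ ≤ M * |w| * |q| * |v - vh| + M * |v - vh| * |q| * |w| := by gcongr
      _ ≤ |v - vh| ^ 2 / 8 + 8 * M ^ 2 * (|w| ^ 2 * |q| ^ 2) := by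
          nlinarith [sq_nonneg (|v - vh| - 8 * M * (|w| * |q|))]
      _ = (v - vh) ^ 2 / 8 + 8 * M ^ 2 * (w ^ 2 * q ^ 2) := by simp only [sq_abs]
      _ ≤ (v - vh) ^ 2 / 8 + 8 * M ^ 2 * (S * q ^ 2) := by gcongr
      _ = _ := by ring
  have t3 : |d * v * (p - q) * w| ≤ S * β⁻¹ ^ 2 * v ^ 2 + M ^ 2 / 4 * β ^ 2 * (p - q) ^ 2 := by
    calc |d * v * (p - q) * w| = |d| * |v| * |p - q| * |w| := by simp only [abs_mul]
      _ ≤ M * |v| * |p - q| * |w| := by gcongr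
      _ = 2 * (β⁻¹ * (|w| * |v|)) * (M * β * |p - q| / 2) := by field_simp
      _ ≤ (β⁻¹ * (|w| * |v|)) ^ 2 + (M * β * |p - q| / 2) ^ 2 := two_mul_le_add_sq _ _
      _ = |w| ^ 2 * (β⁻¹ ^ 2 * |v| ^ 2) + M ^ 2 / 4 * β ^ 2 * |p - q| ^ 2 := by ring
      _ = w ^ 2 * (β⁻¹ ^ 2 * v ^ 2) + M ^ 2 / 4 * β ^ 2 * (p - q) ^ 2 := by simp only [sq_abs]
      _ ≤ S * (β⁻¹ ^ 2 * v ^ 2) + M ^ 2 / 4 * β ^ 2 * (p - q) ^ 2 := by gcongr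
      _ = _ := by ring
  have t4 : |(d - dh) * v * q * w| ≤ M * S * β⁻¹ / 2 * v ^ 2 + M * S * β / 2 * q ^ 2 := by
    calc |(d - dh) * v * q * w| = |d - dh| * |v| * |q| * |w| := by simp only [abs_mul]
      _ ≤ M * |w| * |v| * |q| * |w| := by gcongr
      _ = M * |w| ^ 2 * (|v| * |q|) := by ring
      _ ≤ M * |w| ^ 2 * (β⁻¹ / 2 * |v| ^ 2 + β / 2 * |q| ^ 2) := by
          gcongr
          have h := sq_nonneg (|v| - β * |q|)
          rw [← mul_le_mul_iff_right₀ (show 0 < 2 * β by positivity)]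
          have e : 2 * β * (β⁻¹ / 2 * |v| ^ 2 + β / 2 * |q| ^ 2) = |v| ^ 2 + β ^ 2 * |q| ^ 2 := by
            field_simp
          rw [e]
          nlinarith
      _ = M * w ^ 2 * (β⁻¹ / 2 * v ^ 2 + β / 2 * q ^ 2) := by simp only [sq_abs]
      _ ≤ M * S * (β⁻¹ / 2 * v ^ 2 + β / 2 * q ^ 2) := by gcongr
      _ = _ := by ring
  rw [e]
  refine (abs_add_le _ _).trans ?_
  have := (abs_add_le (F * (p - q) * (v - vh) + ((F - Fh) * q * (v - vh) + dh * (v - vh) * q * w))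
    (d * v * (p - q) * w))
  have := (abs_add_le (F * (p - q) * (v - vh)) ((F - Fh) * q * (v - vh) + dh * (v - vh) * q * w))
  linarith

theorem WeakDerivI.sub {a b : ℝ} {θ θh v vh : ℝ → ℝ} (hθ : IntegrableOn θ (Ioo a b))
    (hθh : IntegrableOn θh (Ioo a b)) (hv : IntegrableOn v (Ioo a b))
    (hvh : IntegrableOn vh (Ioo a b)) (h : WeakDerivI a b θ v) (hh : WeakDerivI a b θh vh) :
    WeakDerivI a b (fun x => θ x - θh x) (fun x => v x - vh x) := by
  intro ψ h1 h2
  have hd : Continuous (deriv ψ) := h1.continuous_deriv (by simp)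
  have i : ∀ {u χ : ℝ → ℝ}, IntegrableOn u (Ioo a b) → Continuous χ →
      IntegrableOn (fun x => u x * χ x) (Ioo a b) := fun hu hχ => by
    simpa only [mul_comm] using integrableOn_mul_of_continuous hu hχ
  simp only [sub_mul]
  rw [integral_sub (i hθ hd) (i hθh hd), integral_sub (i hv h1.continuous) (i hvh h1.continuous),
    h ψ h1 h2, hh ψ h1 h2]
  ring

theorem two_mul_sub_le_of_absorption {M K δ β N X D V2 G E S Q I : ℝ} (hM : 0 < M) (hδ : 0 < δ)
    (hβ : 1 ≤ β) (hN : 0 ≤ N) (hX : 0 ≤ X) (hD : 0 ≤ D) (hG : 0 ≤ G)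
    (hS : S = 2 * (δ * β⁻¹)⁻¹ * N + 2 * (δ * β⁻¹) * X)
    (hE : E = 8 * M ^ 2 * K ^ 2 + 1 + M * (1 + K ^ 2) / 2) (hE0 : 0 ≤ E) (hQ : Q ≤ K ^ 2)
    (hV : V2 ≤ β ^ 2) (hδE : 2 * δ * E ≤ 1 / 4)
    (hI : I ≤ X / 4 + G * β ^ 2 * D + (8 * M ^ 2 * S + M * S * β / 2) * Q
        + (S * β⁻¹ ^ 2 + M * S * β⁻¹ / 2) * V2) :
    2 * (I - X) ≤ -X + (2 * G + 4 * E * δ⁻¹) * (β ^ 2 * (D + N)) := by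
  have hβ0 : 0 < β := by linarith
  have hS0 : 0 ≤ S := by rw [hS]; positivity
  have hSβ : S * β = 2 * δ⁻¹ * (β ^ 2 * N) + 2 * δ * X := by
    rw [hS]; field_simp
  have b1 : (8 * M ^ 2 * S + M * S * β / 2) * Q
      ≤ (8 * M ^ 2 * (S * β) + M * (S * β) / 2) * K ^ 2 := by
    have : S ≤ S * β := le_mul_of_one_le_right hS0 hβ
    calc _ ≤ (8 * M ^ 2 * S + M * S * β / 2) * K ^ 2 := by gcongr
      _ ≤ (8 * M ^ 2 * (S * β) + M * S * β / 2) * K ^ 2 := by gcongr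
      _ = _ := by ring
  have b2 : (S * β⁻¹ ^ 2 + M * S * β⁻¹ / 2) * V2 ≤ S * β + M * (S * β) / 2 := by
    calc _ ≤ (S * β⁻¹ ^ 2 + M * S * β⁻¹ / 2) * β ^ 2 := by
          gcongr
      _ = S + M * (S * β) / 2 := by field_simp
      _ ≤ _ := by
          gcongr
          exact le_mul_of_one_le_right hS0 hβ
  have b3 : S * β * E ≤ 2 * E * δ⁻¹ * (β ^ 2 * N) + X / 4 := by
    rw [hSβ]
    calc (2 * δ⁻¹ * (β ^ 2 * N) + 2 * δ * X) * E
        = 2 * E * δ⁻¹ * (β ^ 2 * N) + 2 * δ * E * X := by ring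
      _ ≤ 2 * E * δ⁻¹ * (β ^ 2 * N) + 1 / 4 * X := by gcongr
      _ = _ := by ring
  have b4 : (8 * M ^ 2 * (S * β) + M * (S * β) / 2) * K ^ 2 + (S * β + M * (S * β) / 2)
      = S * β * E := by
    rw [hE]; ring
  have b5 : 0 ≤ G * (β ^ 2 * N) := by positivity
  have b6 : 0 ≤ E * δ⁻¹ * (β ^ 2 * D) := by positivity
  have b7 : 0 ≤ G * β ^ 2 * D := by positivity
  have e : (2 * G + 4 * E * δ⁻¹) * (β ^ 2 * (D + N)) = 2 * (G * (β ^ 2 * N))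
      + 2 * (G * β ^ 2 * D) + 4 * E * δ⁻¹ * (β ^ 2 * N) + 4 * (E * δ⁻¹ * (β ^ 2 * D)) := by ring
  linarith

/-- The estimate, at a fixed time, of the terms produced by testing the difference of two heat
equations with the difference of the temperatures. -/
theorem exists_slice_bound {a b : ℝ} (hab : a < b) {f f' f'' : ℝ → ℝ} (hf : HypF f f' f'')
    {K : ℝ} (hK : 0 < K) :
    ∃ Γ > 0, ∀ θ θh v vh p q : ℝ → ℝ, MemL2 a b θ → MemL2 a b θh → MemL2 a b v → MemL2 a b vh →
      MemL2 a b p → MemL2 a b q → (∀ᵐ x ∂volume.restrict (Ioo a b), 0 ≤ θ x) →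
      (∀ᵐ x ∂volume.restrict (Ioo a b), 0 ≤ θh x) → WeakDerivI a b θ v → WeakDerivI a b θh vh →
      AEStronglyMeasurable (fun x => f (θ x) * p x - f (θh x) * q x) (volume.restrict (Ioo a b)) →
      AEStronglyMeasurable (fun x => f' (θ x) * v x * p x - f' (θh x) * vh x * q x)
        (volume.restrict (Ioo a b)) →
      nrmL2 a b q + nrmL1 a b θ ≤ K →
      2 * (∫ x in Ioo a b, ((f (θ x) * p x - f (θh x) * q x - (v x - vh x)) * (v x - vh x)
          + (f' (θ x) * v x * p x - f' (θh x) * vh x * q x) * (θ x - θh x)))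
        ≤ -(∫ x in Ioo a b, (v x - vh x) ^ 2)
          + Γ * ((1 + ∫ x in Ioo a b, v x ^ 2) *
            ((∫ x in Ioo a b, (p x - q x) ^ 2) + ∫ x in Ioo a b, (θ x - θh x) ^ 2)) := by
  obtain ⟨M, hM, hf1, hf2, hf3, hf4⟩ := hf.exists_bounds
  set L := b - a with hL
  have hL0 : 0 < L := sub_pos.2 hab
  set C := 2 * (L⁻¹ * K) ^ 2 + 2 * L with hC
  have hC0 : 0 < C := by positivity
  set E := 8 * M ^ 2 * K ^ 2 + 1 + M * (1 + K ^ 2) / 2 with hE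
  have hE0 : 0 < E := by positivity
  set δ := min L (8 * E)⁻¹ with hδ
  have hδ0 : 0 < δ := lt_min hL0 (by positivity)
  have hδE : 2 * δ * E ≤ 1 / 4 := by
    have : δ ≤ (8 * E)⁻¹ := min_le_right _ _
    calc 2 * δ * E ≤ 2 * (8 * E)⁻¹ * E := by gcongr
      _ = 1 / 4 := by field_simp; norm_num
  set G := 2 * M ^ 2 * C + M ^ 2 / 4 with hG
  refine ⟨2 * G + 4 * E * δ⁻¹, by positivity, ?_⟩
  intro θ θh v vh p q hθ hθh hv hvh hp hq hθ0 hθh0 hdθ hdθh hm1 hm2 hnrm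
  have hw := hθ.sub hθh
  have hx := hv.sub hvh
  have hdw := hdθ.sub hθ.integrableOn hθh.integrableOn hv.integrableOn hvh.integrableOn hdθh
  set V2 := ∫ x in Ioo a b, v x ^ 2 with hV2
  have hV20 : 0 ≤ V2 := integral_nonneg fun x => sq_nonneg _
  set β := Real.sqrt (1 + V2) with hβ
  have hβ2 : β ^ 2 = 1 + V2 := Real.sq_sqrt (by positivity)
  have hβ1 : 1 ≤ β := Real.one_le_sqrt.2 (by linarith)
  have hβ0 : 0 < β := by linarith
  set N := ∫ x in Ioo a b, (θ x - θh x) ^ 2 with hN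
  have hN0 : 0 ≤ N := integral_nonneg fun x => sq_nonneg _
  set X := ∫ x in Ioo a b, (v x - vh x) ^ 2 with hX
  have hX0 : 0 ≤ X := integral_nonneg fun x => sq_nonneg _
  set D := ∫ x in Ioo a b, (p x - q x) ^ 2 with hD
  have hD0 : 0 ≤ D := integral_nonneg fun x => sq_nonneg _
  set S := 2 * (δ * β⁻¹)⁻¹ * N + 2 * (δ * β⁻¹) * X with hS
  have hS0 : 0 ≤ S := by positivity
  have hq0 : 0 ≤ ∫ x in Ioo a b, q x ^ 2 := integral_nonneg fun x => sq_nonneg _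
  have hn1 : 0 ≤ nrmL1 a b θ := integral_nonneg fun x => abs_nonneg _
  have hn2 : 0 ≤ nrmL2 a b q := Real.rpow_nonneg hq0 _
  have hqK : ∫ x in Ioo a b, q x ^ 2 ≤ K ^ 2 := by
    have h1 : nrmL2 a b q ^ 2 = ∫ x in Ioo a b, q x ^ 2 := by
      rw [nrmL2, ← Real.sqrt_eq_rpow, Real.sq_sqrt hq0]
    rw [← h1]
    exact pow_le_pow_left₀ hn2 (by linarith) 2
  have hθK : ∫ x in Ioo a b, |θ x| ≤ K := by
    have : nrmL1 a b θ ≤ K := by linarith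
    exact this
  have hbθ : ∀ᵐ x ∂volume.restrict (Ioo a b), θ x ^ 2 ≤ C * β ^ 2 := by
    filter_upwards [hdθ.ae_abs_le hab hL0 le_rfl hθ.integrableOn hv.integrableOn] with x ⟨c, h1, h2, h3⟩
    have hc : c = a := le_antisymm (by linarith) h1
    rw [hc, show a + L = b by simp [hL]] at h3
    have h4 := sq_integral_le hab.le hv.memLp
    have h5 : 0 ≤ ∫ x in Ioo a b, |v x| := integral_nonneg fun x => abs_nonneg _
    have h6 : θ x ^ 2 ≤ (L⁻¹ * K + ∫ x in Ioo a b, |v x|) ^ 2 := by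
      rw [← sq_abs]
      refine pow_le_pow_left₀ (abs_nonneg _) (h3.trans ?_) 2
      gcongr
    have h7 : θ x ^ 2 ≤ 2 * (L⁻¹ * K) ^ 2 + 2 * (L * V2) := by
      have := add_sq_le (a := L⁻¹ * K) (b := ∫ x in Ioo a b, |v x|)
      linarith
    have h8 := mul_nonneg hL0.le hV20
    have h9 := mul_nonneg (sq_nonneg (L⁻¹ * K)) hV20
    have h10 : C * β ^ 2
        = 2 * (L⁻¹ * K) ^ 2 + 2 * L + 2 * ((L⁻¹ * K) ^ 2 * V2) + 2 * (L * V2) := by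
      rw [hβ2, hC]; ring
    linarith
  have hbw : ∀ᵐ x ∂volume.restrict (Ioo a b), (θ x - θh x) ^ 2 ≤ S := by
    refine hdw.ae_sq_le hab (ℓ := δ * β⁻¹) (by positivity) ?_ hw hx
    calc δ * β⁻¹ ≤ L * 1 := by
          gcongr
          · exact min_le_left _ _
          · exact inv_le_one_of_one_le₀ hβ1
      _ = b - a := mul_one _
  have hpw : ∀ᵐ x ∂volume.restrict (Ioo a b),
      |(f (θ x) * p x - f (θh x) * q x) * (v x - vh x)
          + (f' (θ x) * v x * p x - f' (θh x) * vh x * q x) * (θ x - θh x)|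
      ≤ (v x - vh x) ^ 2 / 4 + G * β ^ 2 * (p x - q x) ^ 2
        + (8 * M ^ 2 * S + M * S * β / 2) * q x ^ 2
        + (S * β⁻¹ ^ 2 + M * S * β⁻¹ / 2) * v x ^ 2 := by
    filter_upwards [hbθ, hbw, hθ0, hθh0] with x h1 h2 h3 h4
    refine abs_flux_add_source_le hM hβ0 (hf2 _ _ h3 h4) (hf3 _ _ h3 h4) (hf1 _ h3) (hf1 _ h4) ?_ h2
    rw [← sq_abs]
    calc |f (θ x)| ^ 2 ≤ (M * |θ x|) ^ 2 := pow_le_pow_left₀ (abs_nonneg _) (hf4 _ h3) 2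
      _ = M ^ 2 * θ x ^ 2 := by rw [mul_pow, sq_abs]
      _ ≤ M ^ 2 * (C * β ^ 2) := by gcongr
      _ = _ := by ring
  have j1 : IntegrableOn (fun x => (v x - vh x) ^ 2 / 4) (Ioo a b) := hx.2.div_const 4
  have j2 := (hp.sub hq).2.const_mul (G * β ^ 2)
  have j3 := hq.2.const_mul (8 * M ^ 2 * S + M * S * β / 2)
  have j4 := hv.2.const_mul (S * β⁻¹ ^ 2 + M * S * β⁻¹ / 2)
  have j12 : IntegrableOn (fun x => (v x - vh x) ^ 2 / 4 + G * β ^ 2 * (p x - q x) ^ 2) (Ioo a b) :=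
    j1.add j2
  have j123 : IntegrableOn (fun x => (v x - vh x) ^ 2 / 4 + G * β ^ 2 * (p x - q x) ^ 2
      + (8 * M ^ 2 * S + M * S * β / 2) * q x ^ 2) (Ioo a b) := j12.add j3
  have j1234 : IntegrableOn (fun x => (v x - vh x) ^ 2 / 4 + G * β ^ 2 * (p x - q x) ^ 2
      + (8 * M ^ 2 * S + M * S * β / 2) * q x ^ 2
      + (S * β⁻¹ ^ 2 + M * S * β⁻¹ / 2) * v x ^ 2) (Ioo a b) := j123.add j4
  have iF : IntegrableOn (fun x => (f (θ x) * p x - f (θh x) * q x) * (v x - vh x)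
      + (f' (θ x) * v x * p x - f' (θh x) * vh x * q x) * (θ x - θh x)) (Ioo a b) :=
    j1234.mono' ((hm1.mul hx.1).add (hm2.mul hw.1)) hpw
  have hI : ∫ x in Ioo a b, ((f (θ x) * p x - f (θh x) * q x) * (v x - vh x)
        + (f' (θ x) * v x * p x - f' (θh x) * vh x * q x) * (θ x - θh x))
      ≤ X / 4 + G * β ^ 2 * D + (8 * M ^ 2 * S + M * S * β / 2) * (∫ x in Ioo a b, q x ^ 2)
        + (S * β⁻¹ ^ 2 + M * S * β⁻¹ / 2) * V2 := by
    calc _ ≤ ∫ x in Ioo a b, ((v x - vh x) ^ 2 / 4 + G * β ^ 2 * (p x - q x) ^ 2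
          + (8 * M ^ 2 * S + M * S * β / 2) * q x ^ 2
          + (S * β⁻¹ ^ 2 + M * S * β⁻¹ / 2) * v x ^ 2) :=
        integral_mono_ae iF j1234 (hpw.mono fun x hx => (le_abs_self _).trans hx)
      _ = _ := by
        rw [integral_add j123 j4, integral_add j12 j3, integral_add j1 j2, integral_div,
          integral_const_mul, integral_const_mul, integral_const_mul]
  have hsplit : ∫ x in Ioo a b, ((f (θ x) * p x - f (θh x) * q x - (v x - vh x)) * (v x - vh x)
          + (f' (θ x) * v x * p x - f' (θh x) * vh x * q x) * (θ x - θh x))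
      = (∫ x in Ioo a b, ((f (θ x) * p x - f (θh x) * q x) * (v x - vh x)
        + (f' (θ x) * v x * p x - f' (θh x) * vh x * q x) * (θ x - θh x))) - X := by
    rw [hX, ← integral_sub iF hx.2]
    congr 1
    funext x
    ring
  rw [hsplit, ← hβ2]
  exact two_mul_sub_le_of_absorption hM hδ0 hβ1 hN0 hX0 hD0 (by positivity) hS hE hE0.le hqK
    (by linarith) hδE hI

theorem ae_aestronglyMeasurable_slice {a b T : ℝ} {F : ℝ → ℝ → ℝ}
    (hF : AEStronglyMeasurable (fun p : ℝ × ℝ => F p.1 p.2)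
      (volume.restrict (Ioo a b ×ˢ Ioo 0 T))) :
    ∀ᵐ t ∂volume.restrict (Ioo 0 T),
      AEStronglyMeasurable (fun x => F x t) (volume.restrict (Ioo a b)) := by
  obtain ⟨G, hG, -, -, h⟩ := exists_stronglyMeasurable_extension hF
  filter_upwards [h] with t ht
  exact ⟨fun x => G (x, t), hG.comp_measurable measurable_prodMk_right, ht⟩

theorem ae_memL2_slice {a b T : ℝ} {F : ℝ → ℝ → ℝ}
    (hF : AEStronglyMeasurable (fun p : ℝ × ℝ => F p.1 p.2)
      (volume.restrict (Ioo a b ×ˢ Ioo 0 T)))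
    (hF2 : IntegrableOn (fun p : ℝ × ℝ => F p.1 p.2 ^ 2) (Ioo a b ×ˢ Ioo 0 T)) :
    (∀ᵐ t ∂volume.restrict (Ioo 0 T), MemL2 a b (fun x => F x t)) ∧
      IntegrableOn (fun t => ∫ x in Ioo a b, F x t ^ 2) (Ioo 0 T) := by
  rw [IntegrableOn, volume_restrict_prod] at hF2
  refine ⟨?_, hF2.integral_prod_right⟩
  filter_upwards [ae_aestronglyMeasurable_slice hF, hF2.prod_left_ae] with t h1 h2
  exact ⟨h1, h2⟩

theorem memLp_two_of_slices {a b T : ℝ} {F : ℝ → ℝ → ℝ} {H : ℝ → ℝ}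
    (hF : AEStronglyMeasurable (fun p : ℝ × ℝ => F p.1 p.2)
      (volume.restrict (Ioo a b ×ˢ Ioo 0 T)))
    (hs : ∀ᵐ t ∂volume.restrict (Ioo 0 T),
      IntegrableOn (fun x => F x t ^ 2) (Ioo a b) ∧ ∫ x in Ioo a b, F x t ^ 2 ≤ H t)
    (hH : IntegrableOn H (Ioo 0 T)) :
    MemLp (fun p : ℝ × ℝ => F p.1 p.2) 2 (volume.restrict (Ioo a b ×ˢ Ioo 0 T)) := by
  rw [memLp_two_iff_integrable_sq hF]
  have hF2 := hF.pow 2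
  rw [volume_restrict_prod] at hF2 ⊢
  refine (integrable_prod_iff' hF2).2 ⟨hs.mono fun t h => h.1, ?_⟩
  refine hH.mono' hF2.norm.prod_swap.integral_prod_right' ?_
  filter_upwards [hs] with t ht
  have h0 : 0 ≤ ∫ x in Ioo a b, F x t ^ 2 := integral_nonneg fun x => sq_nonneg _
  simpa [abs_of_nonneg h0] using ht.2

theorem IntegrableOn.setIntegral_prod_mul_sub {a b T : ℝ} {F G : ℝ × ℝ → ℝ}
    (hF : IntegrableOn F (Ioo a b ×ˢ Ioo 0 T)) (hG : IntegrableOn G (Ioo a b ×ˢ Ioo 0 T))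
    {ψ η : ℝ → ℝ} (hψ : Continuous ψ) (hη : Continuous η) :
    ∫ p in Ioo a b ×ˢ Ioo 0 T, (F p - G p) * (ψ p.1 * η p.2)
      = (∫ p in Ioo a b ×ˢ Ioo 0 T, F p * (ψ p.1 * η p.2))
        - ∫ p in Ioo a b ×ˢ Ioo 0 T, G p * (ψ p.1 * η p.2) := by
  have hS : MeasurableSet (Ioo a b ×ˢ Ioo 0 T : Set (ℝ × ℝ)) :=
    measurableSet_Ioo.prod measurableSet_Ioo
  have hφ : Continuous fun p : ℝ × ℝ => ψ p.1 * η p.2 := by fun_prop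
  simp only [sub_mul]
  exact integral_sub (Integrable.mul_bounded_on hS hF hφ (isBounded_Ioo_prod a b 0 T))
    (Integrable.mul_bounded_on hS hG hφ (isBounded_Ioo_prod a b 0 T))

theorem IsWeakSol.weak_temperature_prod {a b T : ℝ} {f f' : ℝ → ℝ} {u0 u0t Θ0 : ℝ → ℝ}
    {u ut ux Θ Θx : ℝ → ℝ → ℝ} (h : IsWeakSol a b T f f' u0 u0t Θ0 u ut ux Θ Θx) {ψ η : ℝ → ℝ}
    (hψ : ContDiff ℝ (⊤ : ℕ∞) ψ) (hη : ContDiff ℝ (⊤ : ℕ∞) η)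
    (hη0 : ∃ T' < T, ∀ t, T' ≤ t → η t = 0) :
    -(∫ p in Ioo a b ×ˢ Ioo 0 T, Θ p.1 p.2 * (ψ p.1 * deriv η p.2))
        - (∫ x in Ioo a b, Θ0 x * (ψ x * η 0))
      = (∫ p in Ioo a b ×ˢ Ioo 0 T,
          (f (Θ p.1 p.2) * ut p.1 p.2 - Θx p.1 p.2) * (deriv ψ p.1 * η p.2))
        + ∫ p in Ioo a b ×ˢ Ioo 0 T,
          f' (Θ p.1 p.2) * Θx p.1 p.2 * ut p.1 p.2 * (ψ p.1 * η p.2) := by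
  obtain ⟨T', hT', hz⟩ := hη0
  have hφ : TestT T fun x t => ψ x * η t :=
    ⟨(hψ.comp contDiff_fst).mul (hη.comp contDiff_snd),
      T', hT', fun x t ht => by simp [hz t ht]⟩
  have key := h.weak_Θ _ hφ
  have e1 : pdt (fun x t => ψ x * η t) = fun x t => ψ x * deriv η t := by
    funext x t
    simp [pdt]
  have e2 : pdx (fun x t => ψ x * η t) = fun x t => deriv ψ x * η t := by
    funext x t
    simp [pdx]
  rw [e1, e2] at key
  simp only [intOmT, intOm] at key
  rw [IntegrableOn.setIntegral_prod_mul_sub h.g3_int h.Θx_int (hψ.continuous_deriv (by simp))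
    hη.continuous, key]
  ring

/-- Integrability of the heat flux and of the source term of a weak solution. -/
theorem IsWeakSol.flux_source_bounds {a b T : ℝ} (hab : a < b) {f f' f'' : ℝ → ℝ}
    (hf : HypF f f' f'') {u0 u0t Θ0 : ℝ → ℝ} {u ut ux Θ Θx : ℝ → ℝ → ℝ}
    (h : IsWeakSol a b T f f' u0 u0t Θ0 u ut ux Θ Θx) (hr : RegT a b T u ut ux Θ Θx) :
    MemLp (fun p : ℝ × ℝ => f (Θ p.1 p.2) * ut p.1 p.2) 2 (volume.restrict (Ioo a b ×ˢ Ioo 0 T)) ∧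
    ∃ H : ℝ → ℝ, IntegrableOn H (Ioo 0 T) ∧ ∀ᵐ t ∂volume.restrict (Ioo 0 T),
      IntegrableOn (fun x => f' (Θ x t) * Θx x t * ut x t) (Ioo a b) ∧
        (∫ x in Ioo a b, |f' (Θ x t) * Θx x t * ut x t|) ^ 2 ≤ H t := by
  obtain ⟨M, hM, hf1, -, -, hf4⟩ := hf.exists_bounds
  have hL : 0 < b - a := sub_pos.2 hab
  obtain ⟨B, hB⟩ := isCompact_Icc.exists_bound_of_continuousOn hr.ut_cont.continuousOn_sq
  obtain ⟨B', hB'⟩ := isCompact_Icc.exists_bound_of_continuousOn hr.Θ_cont.continuousOn_sq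
  obtain ⟨hv, hvI⟩ := ae_memL2_slice h.Θx_int.1 hr.Θx_sq_int
  have hmem : ∀ᵐ t ∂volume.restrict (Ioo 0 T), t ∈ Icc 0 T :=
    (ae_restrict_mem measurableSet_Ioo).mono fun t ht => Ioo_subset_Icc_self ht
  have hΘ0 := ae_slice_of_ae_prod h.Θ_nonneg
  have hc : ∀ c : ℝ, IntegrableOn (fun _ : ℝ => c) (Ioo 0 T) := fun c => integrable_const c
  refine ⟨memLp_two_of_slices (F := fun x t => f (Θ x t) * ut x t) h.g3_int.1
    (H := fun t => M ^ 2 * (2 * (b - a)⁻¹ * B' + 2 * (b - a) * ∫ x in Ioo a b, Θx x t ^ 2) * B)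
    ?_ ((((hc _).add (hvI.const_mul _)).const_mul _).mul_const _),
    fun t => M ^ 2 * (∫ x in Ioo a b, Θx x t ^ 2) * B, (hvI.const_mul _).mul_const _, ?_⟩
  · filter_upwards [hv, hmem, hΘ0, h.Θ_W, ae_aestronglyMeasurable_slice
      (F := fun x t => f (Θ x t) * ut x t) h.g3_int.1] with t h1 h2 h3 h4 h5
    have hut := hr.ut_cont.1 t h2
    have hB1 := (le_abs_self _).trans (hB t h2)
    have hB1' := (le_abs_self _).trans (hB' t h2)
    set c := M ^ 2 * (2 * (b - a)⁻¹ * B' + 2 * (b - a) * ∫ x in Ioo a b, Θx x t ^ 2) with hcdef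
    have hB0 : 0 ≤ B' := (norm_nonneg _).trans (hB' t h2)
    have hc0 : 0 ≤ c := by
      have : 0 ≤ ∫ x in Ioo a b, Θx x t ^ 2 := integral_nonneg fun x => sq_nonneg _
      positivity
    have hb : ∀ᵐ x ∂volume.restrict (Ioo a b), (f (Θ x t) * ut x t) ^ 2 ≤ c * ut x t ^ 2 := by
      filter_upwards [h4.ae_sq_le hab hL le_rfl (hr.Θ_cont.1 t h2) h1, h3] with x h6 h7
      rw [mul_pow]
      gcongr
      calc f (Θ x t) ^ 2 = |f (Θ x t)| ^ 2 := (sq_abs _).symm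
        _ ≤ (M * |Θ x t|) ^ 2 := pow_le_pow_left₀ (abs_nonneg _) (hf4 _ h7) 2
        _ = M ^ 2 * Θ x t ^ 2 := by rw [mul_pow, sq_abs]
        _ ≤ c := by
          rw [hcdef]
          gcongr
          refine h6.trans ?_
          gcongr
    have hi : IntegrableOn (fun x => (f (Θ x t) * ut x t) ^ 2) (Ioo a b) := by
      refine (hut.2.const_mul c).mono' (h5.pow 2) ?_
      filter_upwards [hb] with x hx
      rwa [Real.norm_of_nonneg (sq_nonneg _)]
    refine ⟨hi, ?_⟩
    calc _ ≤ ∫ x in Ioo a b, c * ut x t ^ 2 := integral_mono_ae hi (hut.2.const_mul c) hb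
      _ = c * ∫ x in Ioo a b, ut x t ^ 2 := integral_const_mul _ _
      _ ≤ c * B := by gcongr
  · filter_upwards [hv, hmem, hΘ0, ae_aestronglyMeasurable_slice
      (F := fun x t => f' (Θ x t) * Θx x t * ut x t) h.g2_int.1] with t h1 h2 h3 h5
    have hut := hr.ut_cont.1 t h2
    have hB1 := (le_abs_self _).trans (hB t h2)
    have hb : ∀ᵐ x ∂volume.restrict (Ioo a b),
        |f' (Θ x t) * Θx x t * ut x t| ≤ M * (|Θx x t| * |ut x t|) := by
      filter_upwards [h3] with x h7
      rw [abs_mul, abs_mul, mul_assoc]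
      gcongr
      exact hf1 _ h7
    have hj : Integrable (fun x => M * (|Θx x t| * |ut x t|)) (volume.restrict (Ioo a b)) :=
      (h1.memLp.abs.integrable_mul hut.memLp.abs).const_mul M
    have hi : IntegrableOn (fun x => f' (Θ x t) * Θx x t * ut x t) (Ioo a b) := hj.mono' h5 hb
    refine ⟨hi, ?_⟩
    have h6 := sq_integral_mul_le h1.memLp.abs hut.memLp.abs
    simp only [Pi.abs_apply, sq_abs] at h6
    have h8 : 0 ≤ ∫ x in Ioo a b, Θx x t ^ 2 := integral_nonneg fun x => sq_nonneg _
    calc _ ≤ (∫ x in Ioo a b, M * (|Θx x t| * |ut x t|)) ^ 2 :=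
          pow_le_pow_left₀ (integral_nonneg fun x => abs_nonneg _)
            (integral_mono_ae hi.abs hj hb) 2
      _ = M ^ 2 * (∫ x in Ioo a b, |Θx x t| * |ut x t|) ^ 2 := by
          rw [integral_const_mul, mul_pow]
      _ ≤ M ^ 2 * ((∫ x in Ioo a b, Θx x t ^ 2) * ∫ x in Ioo a b, ut x t ^ 2) := by gcongr
      _ ≤ M ^ 2 * ((∫ x in Ioo a b, Θx x t ^ 2) * B) := by gcongr
      _ = _ := by ring

theorem IsWeakSol.temperature_difference_energy {a b T : ℝ} (hab : a < b) (hT : 0 < T)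
    {f f' f'' : ℝ → ℝ} (hf : HypF f f' f'') {u0 u0t Θ0 uh0 uh0t Θh0 : ℝ → ℝ}
    {u ut ux Θ Θx uh uht uhx Θh Θhx : ℝ → ℝ → ℝ}
    (h : IsWeakSol a b T f f' u0 u0t Θ0 u ut ux Θ Θx) (hr : RegT a b T u ut ux Θ Θx)
    (hh : IsWeakSol a b T f f' uh0 uh0t Θh0 uh uht uhx Θh Θhx) (hrh : RegT a b T uh uht uhx Θh Θhx)
    (hΘ0 : MemL2 a b Θ0) (hΘh0 : MemL2 a b Θh0) :
    IntegrableOn (fun t => ∫ x in Ioo a b,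
      ((f (Θ x t) * ut x t - f (Θh x t) * uht x t - (Θx x t - Θhx x t)) * (Θx x t - Θhx x t)
        + (f' (Θ x t) * Θx x t * ut x t - f' (Θh x t) * Θhx x t * uht x t) * (Θ x t - Θh x t)))
      (Ioo 0 T) ∧
    ∀ τ ∈ Ioo 0 T, (∫ x in Ioo a b, (Θ x τ - Θh x τ) ^ 2) - ∫ x in Ioo a b, (Θ0 x - Θh0 x) ^ 2
      ≤ 2 * ∫ t in Ioo 0 τ, ∫ x in Ioo a b,
      ((f (Θ x t) * ut x t - f (Θh x t) * uht x t - (Θx x t - Θhx x t)) * (Θx x t - Θhx x t)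
        + (f' (Θ x t) * Θx x t * ut x t - f' (Θh x t) * Θhx x t * uht x t)
          * (Θ x t - Θh x t)) := by
  obtain ⟨hF, H, hH, hgH⟩ := h.flux_source_bounds hab hf hr
  obtain ⟨hFh, Hh, hHh, hgHh⟩ := hh.flux_source_bounds hab hf hrh
  have hV := (memLp_two_iff_integrable_sq h.Θx_int.1).2 hr.Θx_sq_int
  have hVh := (memLp_two_iff_integrable_sq hh.Θx_int.1).2 hrh.Θx_sq_int
  refine energy_inequality hab hT (w := fun x t => Θ x t - Θh x t)
    (P := fun x t => f (Θ x t) * ut x t - f (Θh x t) * uht x t - (Θx x t - Θhx x t))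
    (g := fun x t => f' (Θ x t) * Θx x t * ut x t - f' (Θh x t) * Θhx x t * uht x t)
    (V := fun x t => Θx x t - Θhx x t) (w0 := fun x => Θ0 x - Θh0 x)
    (H := fun t => 2 * (H t + Hh t)) (hr.Θ_cont.sub hrh.Θ_cont) (h.Θ_int.sub hh.Θ_int)
    (hΘ0.sub hΘh0) ((hF.sub hFh).sub (hV.sub hVh)) (hV.sub hVh) (h.g2_int.sub hh.g2_int)
    ((hH.add hHh).const_mul 2) ?_ ?_ ?_
  · filter_upwards [hgH, hgHh] with t ⟨h1, h2⟩ ⟨h3, h4⟩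
    have h5 : ∫ x in Ioo a b, |f' (Θ x t) * Θx x t * ut x t - f' (Θh x t) * Θhx x t * uht x t|
        ≤ (∫ x in Ioo a b, |f' (Θ x t) * Θx x t * ut x t|)
          + ∫ x in Ioo a b, |f' (Θh x t) * Θhx x t * uht x t| := by
      rw [← integral_add h1.abs h3.abs]
      exact integral_mono (h1.sub h3).abs (h1.abs.add h3.abs) fun x => abs_sub _ _
    calc _ ≤ ((∫ x in Ioo a b, |f' (Θ x t) * Θx x t * ut x t|)
          + ∫ x in Ioo a b, |f' (Θh x t) * Θhx x t * uht x t|) ^ 2 :=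
          pow_le_pow_left₀ (integral_nonneg fun x => abs_nonneg _) h5 2
      _ ≤ _ := add_sq_le
      _ ≤ _ := by gcongr
  · intro ψ η hψ hη hη0
    have hψ' : Continuous (deriv ψ) := hψ.continuous_deriv (by simp)
    have hη' : Continuous (deriv η) := hη.continuous_deriv (by simp)
    have e1 := h.weak_temperature_prod hψ hη hη0
    have e2 := hh.weak_temperature_prod hψ hη hη0
    have s0 : ∀ {z : ℝ → ℝ}, MemL2 a b z →
        IntegrableOn (fun x => z x * (ψ x * η 0)) (Ioo a b) := fun hz =>
      hz.memLp.integrable_mul (memLp_two_of_continuous a b (by fun_prop))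
    have s1 : ∫ x in Ioo a b, (Θ0 x - Θh0 x) * (ψ x * η 0)
        = (∫ x in Ioo a b, Θ0 x * (ψ x * η 0)) - ∫ x in Ioo a b, Θh0 x * (ψ x * η 0) := by
      simp only [sub_mul]
      exact integral_sub (s0 hΘ0) (s0 hΘh0)
    have s2 := IntegrableOn.setIntegral_prod_mul_sub h.Θ_int hh.Θ_int hψ.continuous hη'
    have s3 := IntegrableOn.setIntegral_prod_mul_sub h.g2_int hh.g2_int hψ.continuous
      hη.continuous
    have s4 := IntegrableOn.setIntegral_prod_mul_sub (h.g3_int.sub h.Θx_int)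
      (hh.g3_int.sub hh.Θx_int) hψ' hη.continuous
    simp only [Pi.sub_apply] at s4
    have s5 : ∫ p in Ioo a b ×ˢ Ioo 0 T, (f (Θ p.1 p.2) * ut p.1 p.2
        - f (Θh p.1 p.2) * uht p.1 p.2 - (Θx p.1 p.2 - Θhx p.1 p.2)) * (deriv ψ p.1 * η p.2)
        = ∫ p in Ioo a b ×ˢ Ioo 0 T, (f (Θ p.1 p.2) * ut p.1 p.2 - Θx p.1 p.2
          - (f (Θh p.1 p.2) * uht p.1 p.2 - Θhx p.1 p.2)) * (deriv ψ p.1 * η p.2) := by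
      congr 1
      funext p
      ring
    rw [s1, s2, s3, s5, s4]
    linarith
  · have m1 := (ae_memL2_slice h.Θx_int.1 hr.Θx_sq_int).1
    have m2 := (ae_memL2_slice hh.Θx_int.1 hrh.Θx_sq_int).1
    filter_upwards [h.Θ_W, hh.Θ_W, m1, m2, ae_restrict_mem measurableSet_Ioo] with t h1 h2 h3 h4 h5
    have h6 := Ioo_subset_Icc_self h5
    exact h1.sub (hr.Θ_cont.1 t h6).integrableOn (hrh.Θ_cont.1 t h6).integrableOn h3.integrableOn
      h4.integrableOn h2

/-- Lemma 3.1: estimate for the difference of the temperature components. -/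
theorem statement3
    (a b : ℝ) (hab : a < b)
    (f f' f'' : ℝ → ℝ) (hf : HypF f f' f'')
    (K : ℝ) (hK : 0 < K) :
    ∃ Γ > (0 : ℝ), ∀ T > (0 : ℝ),
      ∀ u0 u0x u0t Θ0 uh0 uh0x uh0t Θh0 : ℝ → ℝ,
      ∀ u ut ux Θ Θx uh uht uhx Θh Θhx : ℝ → ℝ → ℝ,
      DataI a b u0 u0x u0t Θ0 → DataI a b uh0 uh0x uh0t Θh0 →
      IsWeakSol a b T f f' u0 u0t Θ0 u ut ux Θ Θx →
      RegT a b T u ut ux Θ Θx →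
      IsWeakSol a b T f f' uh0 uh0t Θh0 uh uht uhx Θh Θhx →
      RegT a b T uh uht uhx Θh Θhx →
      (∀ t ∈ Ioo 0 T, nrmL2 a b (fun x => uht x t) + nrmL1 a b (fun x => Θ x t) ≤ K) →
      ∀ t ∈ Ioo 0 T,
        (∫ x in Ioo a b, (Θ x t - Θh x t) ^ 2)
            + (∫ s in Ioo (0 : ℝ) t, ∫ x in Ioo a b, (Θx x s - Θhx x s) ^ 2)
          ≤ (∫ x in Ioo a b, (Θ0 x - Θh0 x) ^ 2)
            + Γ * ∫ s in Ioo (0 : ℝ) t,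
                (1 + ∫ x in Ioo a b, (Θx x s) ^ 2) *
                  ((∫ x in Ioo a b, (ut x s - uht x s) ^ 2)
                    + ∫ x in Ioo a b, (Θ x s - Θh x s) ^ 2) := by
  obtain ⟨Γ, hΓ, hmain⟩ := exists_slice_bound hab hf hK
  refine ⟨Γ, hΓ, ?_⟩
  intro T hT u0 u0x u0t Θ0 uh0 uh0x uh0t Θh0 u ut ux Θ Θx uh uht uhx Θh Θhx hd hdh h hr hh hrh
    hbound τ hτ
  obtain ⟨hI, hE⟩ := h.temperature_difference_energy hab hT hf hr hh hrh hd.Θ0_L2 hdh.Θ0_L2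
  obtain ⟨m1, n1⟩ := ae_memL2_slice h.Θx_int.1 hr.Θx_sq_int
  obtain ⟨m2, -⟩ := ae_memL2_slice hh.Θx_int.1 hrh.Θx_sq_int
  have hV := (memLp_two_iff_integrable_sq h.Θx_int.1).2 hr.Θx_sq_int
  have hVh := (memLp_two_iff_integrable_sq hh.Θx_int.1).2 hrh.Θx_sq_int
  have n3 : IntegrableOn (fun s => ∫ x in Ioo a b, (Θx x s - Θhx x s) ^ 2) (Ioo 0 T) :=
    (ae_memL2_slice (F := fun x t => Θx x t - Θhx x t) (hV.sub hVh).1 (hV.sub hVh).integrable_sq).2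
  have hcont : ContinuousOn (fun s => (∫ x in Ioo a b, (ut x s - uht x s) ^ 2)
      + ∫ x in Ioo a b, (Θ x s - Θh x s) ^ 2) (Icc 0 T) :=
    (hr.ut_cont.sub hrh.ut_cont).continuousOn_sq.add (hr.Θ_cont.sub hrh.Θ_cont).continuousOn_sq
  obtain ⟨B, hB⟩ := isCompact_Icc.exists_bound_of_continuousOn hcont
  have n4 : IntegrableOn (fun s => (1 + ∫ x in Ioo a b, Θx x s ^ 2) *
      ((∫ x in Ioo a b, (ut x s - uht x s) ^ 2) + ∫ x in Ioo a b, (Θ x s - Θh x s) ^ 2))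
      (Ioo 0 T) := by
    refine ((integrable_const (1 : ℝ)).add n1).mul_bdd (c := B)
      ((hcont.mono Ioo_subset_Icc_self).aestronglyMeasurable measurableSet_Ioo) ?_
    filter_upwards [ae_restrict_mem measurableSet_Ioo] with s hs using
      hB s (Ioo_subset_Icc_self hs)
  have hsub : Ioo 0 τ ⊆ Ioo 0 T := Ioo_subset_Ioo_right hτ.2.le
  have hae : ∀ᵐ s ∂volume.restrict (Ioo 0 T), 2 * (∫ x in Ioo a b,
      ((f (Θ x s) * ut x s - f (Θh x s) * uht x s - (Θx x s - Θhx x s)) * (Θx x s - Θhx x s)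
        + (f' (Θ x s) * Θx x s * ut x s - f' (Θh x s) * Θhx x s * uht x s) * (Θ x s - Θh x s)))
      ≤ -(∫ x in Ioo a b, (Θx x s - Θhx x s) ^ 2)
        + Γ * ((1 + ∫ x in Ioo a b, Θx x s ^ 2) *
          ((∫ x in Ioo a b, (ut x s - uht x s) ^ 2)
            + ∫ x in Ioo a b, (Θ x s - Θh x s) ^ 2)) := by
    filter_upwards [m1, m2, h.Θ_W, hh.Θ_W, ae_slice_of_ae_prod h.Θ_nonneg,
      ae_slice_of_ae_prod hh.Θ_nonneg, ae_restrict_mem measurableSet_Ioo,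
      ae_aestronglyMeasurable_slice (F := fun x t => f (Θ x t) * ut x t - f (Θh x t) * uht x t)
        (h.g3_int.sub hh.g3_int).1,
      ae_aestronglyMeasurable_slice (F := fun x t => f' (Θ x t) * Θx x t * ut x t
        - f' (Θh x t) * Θhx x t * uht x t) (h.g2_int.sub hh.g2_int).1]
      with s h1 h2 h3 h4 h5 h6 h7 h8 h9
    have h10 := Ioo_subset_Icc_self h7
    exact hmain (fun x => Θ x s) (fun x => Θh x s) (fun x => Θx x s) (fun x => Θhx x s)
      (fun x => ut x s) (fun x => uht x s) (hr.Θ_cont.1 s h10) (hrh.Θ_cont.1 s h10) h1 h2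
      (hr.ut_cont.1 s h10) (hrh.ut_cont.1 s h10) h5 h6 h3 h4 h8 h9 (hbound s h7)
  have i1 := (hI.mono_set hsub).const_mul 2
  have i2 := (n3.mono_set hsub).neg
  have i3 := (n4.mono_set hsub).const_mul Γ
  have hfin := integral_mono_ae i1 (i2.add i3)
    (ae_mono (Measure.restrict_mono hsub le_rfl) hae)
  rw [integral_const_mul] at hfin
  have hsum := integral_add i2 i3
  simp only [Pi.neg_apply] at hsum
  rw [integral_neg, integral_const_mul] at hsum
  have := hE τ hτ
  have h1 := hfin.trans_eq hsum
  linarith
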